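/- arXiv:cs/0204037 — 3 statements merged into one kernel-verified Lean document; each statement's English description precedes it below -/
import Mathlib

section
/- There is a constant c such that for every n, every finite set S of binary strings of length n, every natural number d, and every subset P of S containing at least a fraction 1 − 2^{−d} of the elements of S, every x ∈ S with randomness deficiency δ(x|S) ≤ d − K(P|S) − c belongs to P. -/
open scoped Classical

/-- Binary strings. -/
abbrev BStr : Type := List Bool

/-- A prefix (Turing) machine: a partial computable map taking a program and an
auxiliary input to an output, such that for each auxiliary input the set of
halting programs is prefix-free. -/
structure PrefixMachine where
  eval : BStr → BStr → Part BStr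
  partrec' : Partrec fun p : BStr × BStr => eval p.1 p.2
  prefixFree : ∀ y p q, (eval p y).Dom → (eval q y).Dom → p <+: q → p = q

/-- A universal prefix machine: it simulates every prefix machine via a fixed
self-delimiting prefix. -/
structure UniversalPrefixMachine extends PrefixMachine where
  universal : ∀ M : PrefixMachine, ∃ s : BStr, ∀ p y,
    toPrefixMachine.eval (s ++ p) y = M.eval p y

/-- Canonical binary-string encoding of an encodable object (e.g. a natural
number, a pair, or a finite set of strings, the latter representing a literal
listing of the set). -/
def code {α : Type} [Encodable α] (a : α) : BStr := Nat.bits (Encodable.encode a)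

namespace UniversalPrefixMachine

variable (U : UniversalPrefixMachine)

/-- Conditional prefix Kolmogorov complexity `K(x|y)` of a string given a string. -/
noncomputable def Kc (x y : BStr) : ℕ :=
  sInf {n | ∃ p : BStr, p.length = n ∧ x ∈ U.eval p y}

/-- Prefix Kolmogorov complexity `K(x)`. -/
noncomputable def K (x : BStr) : ℕ := U.Kc x []

/-- `K(x|S)`: conditional complexity of `x` given a literal listing of the finite set `S`. -/
noncomputable def KcS (x : BStr) (S : Finset BStr) : ℕ := U.Kc x (code S)

/-- `K(S)`: complexity of a listing of the finite set `S`. -/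
noncomputable def Kset (S : Finset BStr) : ℕ := U.K (code S)

/-- `K(P|S)`: conditional complexity of a listing of `P` given a listing of `S`. -/
noncomputable def KsetCond (P S : Finset BStr) : ℕ := U.Kc (code P) (code S)

/-- `K(S|x)`: conditional complexity of a listing of `S` given the string `x`. -/
noncomputable def KsetGivenStr (S : Finset BStr) (x : BStr) : ℕ := U.Kc (code S) x

/-- `K(n)` for a natural number `n`. -/
noncomputable def Knat (n : ℕ) : ℕ := U.K (code n)

/-- `K(a|b)` for natural numbers `a`, `b`. -/
noncomputable def KnatCond (a b : ℕ) : ℕ := U.Kc (code a) (code b)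

/-- Randomness deficiency `δ(x|S) = log|S| - K(x|S)` (logarithm base 2). -/
noncomputable def deficiency (x : BStr) (S : Finset BStr) : ℝ :=
  Real.logb 2 (S.card : ℝ) - (U.KcS x S : ℝ)

/-- `Λ(S) = K(S) + log|S|`. -/
noncomputable def Lam (S : Finset BStr) : ℝ :=
  (U.Kset S : ℝ) + Real.logb 2 (S.card : ℝ)

/-- Kolmogorov structure function `h_x(α) = min{log|S| : x ∈ S, K(S) ≤ α}`
(the minimum of the empty set being `⊤`). -/
noncomputable def h (x : BStr) (α : ℕ) : EReal :=
  sInf {r : EReal | ∃ S : Finset BStr,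
    x ∈ S ∧ U.Kset S ≤ α ∧ r = ((Real.logb 2 (S.card : ℝ)) : EReal)}

/-- MDL structure function `λ_x(α) = min{Λ(S) : x ∈ S, K(S) ≤ α}`. -/
noncomputable def lambdaF (x : BStr) (α : ℕ) : EReal :=
  sInf {r : EReal | ∃ S : Finset BStr,
    x ∈ S ∧ U.Kset S ≤ α ∧ r = ((U.Lam S) : EReal)}

/-- Best-fit structure function `β_x(α) = min{δ(x|S) : x ∈ S, K(S) ≤ α}`. -/
noncomputable def betaF (x : BStr) (α : ℕ) : EReal :=
  sInf {r : EReal | ∃ S : Finset BStr,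
    x ∈ S ∧ U.Kset S ≤ α ∧ r = ((U.deficiency x S) : EReal)}

end UniversalPrefixMachine

/-- `f` is `(ε,δ)`-close to `g` on `{0,…,k}`. -/
def IsClose (k : ℕ) (ε δ : ℕ → ℕ) (f g : ℕ → EReal) : Prop :=
  ∀ i, ε 0 ≤ i → i ≤ k →
    sInf {r : EReal | ∃ j, ε 0 ≤ j ∧ j ≤ k ∧ Nat.dist j i ≤ ε i ∧ r = g j}
        - (((δ i : ℕ) : ℝ) : EReal) ≤ f i ∧
    f i ≤ sSup {r : EReal | ∃ j, ε 0 ≤ j ∧ j ≤ k ∧ Nat.dist j i ≤ ε i ∧ r = g j}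
        + (((δ i : ℕ) : ℝ) : EReal)

namespace DefProof

open Encodable

/-- Value of a little-endian bit list. -/
def ofBits (l : BStr) : ℕ := l.foldr (fun b n => Nat.bit b n) 0

theorem ofBits_bits (n : ℕ) : ofBits (Nat.bits n) = n := by
  induction n using Nat.binaryRec' with
  | zero => simp [ofBits]
  | bit b n h ih =>
    rw [Nat.bits_append_bit _ _ h]
    simpa [ofBits] using congrArg (Nat.bit b) ih

theorem ofBits_pad (l : BStr) (k : ℕ) : ofBits (l ++ List.replicate k false) = ofBits l := by
  have h0 : ofBits (List.replicate k false) = 0 := by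
    induction k with
    | zero => simp [ofBits]
    | succ k ih => 
      rw [List.replicate_succ]
      show Nat.bit false (ofBits (List.replicate k false)) = 0
      rw [ih]; rfl
  unfold ofBits at *
  rw [List.foldr_append, h0]

theorem exists_bits (i L : ℕ) (h : i < 2 ^ L) : ∃ q : BStr, q.length = L ∧ ofBits q = i := by
  have hs : (Nat.bits i).length ≤ L := by
    rw [Nat.size_eq_bits_len]
    exact Nat.size_le.2 h
  refine ⟨Nat.bits i ++ List.replicate (L - (Nat.bits i).length) false, ?_, ?_⟩
  · simp; omega
  · rw [ofBits_pad, ofBits_bits]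

theorem primrec_bit : Primrec₂ Nat.bit := by
  have : Primrec₂ (fun (b : Bool) (n : ℕ) => cond b (2 * n + 1) (2 * n)) := by
    refine Primrec.cond Primrec.fst ?_ ?_
    · exact Primrec.succ.comp (Primrec.nat_mul.comp (Primrec.const 2) Primrec.snd)
    · exact Primrec.nat_mul.comp (Primrec.const 2) Primrec.snd
  refine this.of_eq ?_
  intro b n
  cases b <;> rfl

theorem primrec_ofBits : Primrec ofBits := by
  unfold ofBits
  refine Primrec.list_foldr (h := fun _ x => Nat.bit x.1 x.2) Primrec.id (Primrec.const 0) ?_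
  exact (primrec_bit.comp (Primrec.fst.comp Primrec.snd) (Primrec.snd.comp Primrec.snd))

theorem primrec_pow2 : Primrec (fun n : ℕ => 2 ^ n) := by
  have : Primrec (fun n : ℕ => n.rec (motive := fun _ => ℕ) 1 (fun _ ih => 2 * ih)) := by
    refine Primrec.nat_rec' (f := fun n => n) (g := fun _ => 1) (h := fun _ p => 2 * p.2)
      Primrec.id (Primrec.const 1) ?_
    exact Primrec.nat_mul.comp (Primrec.const 2) (Primrec.snd.comp Primrec.snd)
  refine this.of_eq ?_
  intro n
  induction n with
  | zero => rfl
  | succ n ih => simp only [pow_succ]; rw [← ih]; ring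

/-- Decode a listing. -/
def lst (v : BStr) : List BStr := (decode (α := List BStr) (ofBits v)).getD []

theorem primrec_lst : Primrec lst := by
  exact Primrec.option_getD.comp (Primrec.decode.comp primrec_ofBits) (Primrec.const [])

/-- difference of two listings -/
def dif (v y : BStr) : List BStr := (lst y).filter (fun a => decide (¬ a ∈ lst v))

theorem primrec_dif : Primrec₂ dif := by
  have hm : PrimrecRel (fun (L : List BStr) (b : BStr) => ∃ a ∈ L, a = b) :=
    PrimrecRel.exists_mem_list Primrec.eq
  have hR : PrimrecRel (fun (b : BStr) (L : List BStr) => ¬ ∃ a ∈ L, a = b) :=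
    PrimrecPred.not (hm.comp Primrec.snd Primrec.fst)
  have := (PrimrecRel.listFilter hR).comp (primrec_lst.comp Primrec.snd)
    (primrec_lst.comp Primrec.fst) (α := BStr × BStr)
  refine Primrec.of_eq this ?_
  intro a
  simp [dif]

theorem exists_lst (S : Finset BStr) : ∃ l : List BStr, (l : Multiset BStr) = S.val ∧
    lst (code S) = l := by
  have h : Option.map ((↑) : List BStr → Multiset BStr)
      (decode (α := List BStr) (encode S)) = some S.val := encodek S.val
  rw [Option.map_eq_some_iff] at h
  obtain ⟨l, h2, h1⟩ := h
  refine ⟨l, h1, ?_⟩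
  rw [lst, code, ofBits_bits, h2]
  rfl

theorem mem_lst (S : Finset BStr) (x : BStr) : x ∈ lst (code S) ↔ x ∈ S := by
  obtain ⟨l, h1, h2⟩ := exists_lst S
  rw [h2, ← Finset.mem_val, ← h1]; simp

theorem length_dif (P S : Finset BStr) : (dif (code P) (code S)).length = (S \ P).card := by
  obtain ⟨l, h1, h2⟩ := exists_lst S
  have hnd : l.Nodup := by
    have := S.nodup
    rw [← h1] at this
    simpa using this
  have hd : (dif (code P) (code S)).Nodup := by
    unfold dif; rw [h2]; exact hnd.filter _
  rw [← List.toFinset_card_of_nodup hd]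
  congr 1
  ext x
  simp [dif, mem_lst]

/-- second-stage decoder -/
def g (v q y : BStr) : Option BStr :=
  if (dif v y).length < 2 ^ q.length ∧ 2 ^ q.length ≤ 2 * (dif v y).length then
    (dif v y)[ofBits q]? else none

theorem primrec_g : Primrec (fun a : BStr × BStr × BStr => g a.1 a.2.1 a.2.2) := by
  have hd : Primrec (fun a : BStr × BStr × BStr => dif a.1 a.2.2) :=
    primrec_dif.comp Primrec.fst (Primrec.snd.comp Primrec.snd)
  have hl := Primrec.list_length.comp hd
  have hq : Primrec (fun a : BStr × BStr × BStr => a.2.1) := Primrec.fst.comp Primrec.snd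
  have hp := primrec_pow2.comp (Primrec.list_length.comp hq)
  have h1 := Primrec.nat_lt.comp hl hp
  have h2 := Primrec.nat_le.comp hp (Primrec.nat_mul.comp (Primrec.const 2) hl)
  have := Primrec.ite (h1.and h2) (Primrec.list_getElem?.comp hd (primrec_ofBits.comp hq))
    (Primrec.const none)
  refine this.of_eq ?_
  intro a
  unfold g
  congr

theorem g_len {v p q y a b : BStr} (h1 : g v p y = some a) (h2 : g v q y = some b) :
    p.length = q.length := by
  unfold g at h1 h2
  split_ifs at h1 h2 with c1 c2
  obtain ⟨c1, c1'⟩ := c1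
  obtain ⟨c2, c2'⟩ := c2
  rcases lt_trichotomy p.length q.length with h | h | h
  · have : 2 ^ (p.length + 1) ≤ 2 ^ q.length := Nat.pow_le_pow_right (by norm_num) h
    rw [pow_succ] at this; omega
  · exact h
  · have : 2 ^ (q.length + 1) ≤ 2 ^ p.length := Nat.pow_le_pow_right (by norm_num) h
    rw [pow_succ] at this; omega

theorem exists_machine (U : PrefixMachine) : ∃ M : PrefixMachine, ∀ p q y v x,
    v ∈ U.eval p y → g v q y = some x → x ∈ M.eval (p ++ q) y := by
  obtain ⟨c, hc⟩ := Nat.Partrec.Code.exists_code.1 U.partrec'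
  have hc' : ∀ p y (v : BStr), v ∈ U.eval p y ↔
      ∃ k, Nat.Partrec.Code.evaln k c (encode (p, y)) = some (encode v) := by
    intro p y v
    have h : encode v ∈ c.eval (encode (p, y)) ↔ v ∈ U.eval p y := by
      rw [hc]; simp
    rw [← h, Nat.Partrec.Code.evaln_complete]
    rfl
  have hc2 : ∀ p y k m, Nat.Partrec.Code.evaln k c (encode (p, y)) = some m →
      ∃ v, v ∈ U.eval p y ∧ m = encode v := by
    intro p y k m h
    have h2 := Nat.Partrec.Code.evaln_sound (x := m) h
    rw [hc] at h2
    simp at h2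
    obtain ⟨v, hv, e⟩ := h2
    exact ⟨v, hv, e.symm⟩
  let f : BStr × BStr → ℕ → Option BStr := fun a m =>
    (Nat.Partrec.Code.evaln m.unpair.1 c (encode (a.1.take m.unpair.2, a.2))).bind fun w =>
      (decode (α := BStr) w).bind fun v => g v (a.1.drop m.unpair.2) a.2
  have hf : Primrec₂ f := by
    have hp : Primrec (fun z : (BStr × BStr) × ℕ => z.1.1) := Primrec.fst.comp Primrec.fst
    have hy : Primrec (fun z : (BStr × BStr) × ℕ => z.1.2) := Primrec.snd.comp Primrec.fst
    have hk : Primrec (fun z : (BStr × BStr) × ℕ => z.2.unpair.1) :=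
      Primrec.fst.comp (Primrec.unpair.comp Primrec.snd)
    have hi : Primrec (fun z : (BStr × BStr) × ℕ => z.2.unpair.2) :=
      Primrec.snd.comp (Primrec.unpair.comp Primrec.snd)
    refine Primrec.option_bind ?_ ?_
    · exact Nat.Partrec.Code.primrec_evaln.comp (Primrec.pair (Primrec.pair hk (Primrec.const c))
        (Primrec.encode.comp (Primrec.pair (Primrec.list_take.comp hi hp) hy)))
    · refine Primrec.option_bind (Primrec.decode.comp Primrec.snd) ?_
      exact primrec_g.comp (Primrec.pair Primrec.snd (Primrec.pair
        ((Primrec.list_drop.comp hi hp).comp (Primrec.fst.comp Primrec.fst))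
        (hy.comp (Primrec.fst.comp Primrec.fst))))
  have f1 : ∀ r y m x, f (r, y) m = some x →
      ∃ p q v, r = p ++ q ∧ v ∈ U.eval p y ∧ g v q y = some x := by
    intro r y m x h
    simp only [f, Option.bind_eq_some_iff] at h
    obtain ⟨w, h1, v, h2, h3⟩ := h
    obtain ⟨v', hv', rfl⟩ := hc2 _ _ _ _ h1
    rw [encodek] at h2
    cases h2
    exact ⟨_, _, _, (List.take_append_drop m.unpair.2 r).symm, hv', h3⟩
  have f2 : ∀ p q y v x, v ∈ U.eval p y → g v q y = some x → ∃ m, f (p ++ q, y) m = some x := by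
    intro p q y v x hv hg
    obtain ⟨k, hk⟩ := (hc' _ _ _).1 hv
    refine ⟨Nat.pair k p.length, ?_⟩
    simp only [f, Nat.unpair_pair, List.take_left', List.drop_left', hk, Option.bind_some, encodek, hg]
  have key : ∀ p q v x p' q' v' x' y, v ∈ U.eval p y → g v q y = some x →
      v' ∈ U.eval p' y → g v' q' y = some x' → p ++ q <+: p' ++ q' →
      p ++ q = p' ++ q' ∧ x = x' := by
    intro p q v x p' q' v' x' y hv hg hv' hg' hpre
    have hpp : p = p' := by
      have a1 : p <+: p' ++ q' := (List.prefix_append p q).trans hpre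
      have a2 : p' <+: p' ++ q' := List.prefix_append p' q'
      rcases List.prefix_or_prefix_of_prefix a1 a2 with h | h
      · exact U.prefixFree y _ _ (Part.dom_iff_mem.2 ⟨_, hv⟩) (Part.dom_iff_mem.2 ⟨_, hv'⟩) h
      · exact (U.prefixFree y _ _ (Part.dom_iff_mem.2 ⟨_, hv'⟩) (Part.dom_iff_mem.2 ⟨_, hv⟩) h).symm
    subst hpp
    have hvv := Part.mem_unique hv hv'
    subst hvv
    have hl := g_len hg hg'
    have hqq : q = q' := ((List.prefix_append_right_inj p).1 hpre).eq_of_length hl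
    subst hqq
    rw [hg] at hg'
    exact ⟨rfl, Option.some.inj hg'⟩
  refine ⟨⟨fun p y => Nat.rfindOpt (f (p, y)), ?_, ?_⟩, ?_⟩
  · exact Partrec.rfindOpt hf.to_comp
  · intro y r s hr hs hrs
    obtain ⟨m, x, hm⟩ := Nat.rfindOpt_dom.1 hr
    obtain ⟨m', x', hm'⟩ := Nat.rfindOpt_dom.1 hs
    obtain ⟨p, q, v, rfl, hv, hg⟩ := f1 _ _ _ _ hm
    obtain ⟨p', q', v', rfl, hv', hg'⟩ := f1 _ _ _ _ hm'
    exact (key _ _ _ _ _ _ _ _ _ hv hg hv' hg' hrs).1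
  · intro p q y v x hv hg
    obtain ⟨m, hm⟩ := f2 _ _ _ _ _ hv hg
    have hdom : (Nat.rfindOpt (f (p ++ q, y))).Dom := Nat.rfindOpt_dom.2 ⟨m, x, hm⟩
    obtain ⟨x', hx'⟩ := Part.dom_iff_mem.1 hdom
    obtain ⟨m', hm'⟩ := Nat.rfindOpt_spec hx'
    obtain ⟨p', q', v', e, hv', hg'⟩ := f1 _ _ _ _ hm'
    have := (key _ _ _ _ _ _ _ _ _ hv hg hv' hg' (e ▸ List.prefix_rfl)).2
    subst this
    exact (id hx')

/-- machine printing a fixed string on the empty program -/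
theorem exists_const (w : BStr) : ∃ M : PrefixMachine, ∀ y, w ∈ M.eval [] y := by
  let f : BStr × BStr → Option BStr := fun a => if a.1 = [] then some w else none
  have hf : Primrec f := by
    refine Primrec.of_eq (Primrec.ite (Primrec.eq.comp Primrec.fst (Primrec.const []))
      (Primrec.const (some w)) (Primrec.const none)) ?_
    intro a
    simp only [f]
  refine ⟨⟨fun p y => (f (p, y) : Part BStr), hf.to_comp.ofOption, ?_⟩, ?_⟩
  · intro y p q hp hq _
    have : ∀ r, (f (r, y) : Part BStr).Dom → r = [] := by
      intro r hr
      by_contra hne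
      simp [f, hne] at hr
    rw [this p hp, this q hq]
  · intro y
    simp [f]

theorem Kc_attained (U : UniversalPrefixMachine) (x y : BStr) :
    ∃ p : BStr, p.length = U.Kc x y ∧ x ∈ U.eval p y := by
  have : {n | ∃ p : BStr, p.length = n ∧ x ∈ U.eval p y}.Nonempty := by
    obtain ⟨M, hM⟩ := exists_const x
    obtain ⟨s, hs⟩ := U.universal M
    exact ⟨_, s ++ [], rfl, by rw [hs]; exact hM y⟩
  exact Nat.sInf_mem this

theorem main_bound (U : UniversalPrefixMachine) : ∃ c : ℕ, ∀ (S P : Finset BStr) (x : BStr),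
    x ∈ S → x ∉ P → ∃ L : ℕ, 2 ^ L ≤ 2 * (S \ P).card ∧
      U.KcS x S ≤ c + U.KsetCond P S + L := by
  obtain ⟨M, hM⟩ := exists_machine U.toPrefixMachine
  obtain ⟨s, hs⟩ := U.universal M
  refine ⟨s.length, fun S P x hxS hxP => ?_⟩
  have hx : x ∈ dif (code P) (code S) := by simp [dif, mem_lst, hxS, hxP]
  obtain ⟨i, hi, hix⟩ := List.getElem_of_mem hx
  have hlen := length_dif P S
  have hpos : (S \ P).card ≠ 0 := by omega
  set N := (S \ P).card with hN
  have hlog : 2 ^ Nat.log 2 N ≤ N := Nat.pow_log_le_self 2 hpos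
  have hlog' : N < 2 ^ (Nat.log 2 N + 1) := Nat.lt_pow_succ_log_self (by norm_num) N
  refine ⟨Nat.log 2 N + 1, by rw [pow_succ]; omega, ?_⟩
  obtain ⟨q, hq, hqi⟩ := exists_bits i (Nat.log 2 N + 1) (by omega)
  obtain ⟨p, hp, hpP⟩ := Kc_attained U (code P) (code S)
  have hg : g (code P) q (code S) = some x := by
    unfold g
    rw [if_pos, hqi, List.getElem?_eq_getElem hi, hix]
    rw [hlen, hq]
    refine ⟨hlog', by rw [pow_succ]; omega⟩
  have := hM _ _ _ _ _ hpP hg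
  rw [← hs] at this
  refine (Nat.sInf_le (m := (s ++ (p ++ q)).length)
    (show _ ∈ {n | ∃ p : BStr, p.length = n ∧ x ∈ U.eval p (code S)} from ⟨_, rfl, this⟩)).trans ?_
  simp only [List.length_append, UniversalPrefixMachine.KsetCond]
  omega

end DefProof

/-- There is a constant `c` such that if `P ⊆ S` contains at least a
fraction `1 - 2^{-d}` of the elements of `S`, then every `x ∈ S` with
`δ(x|S) ≤ d - K(P|S) - c` belongs to `P`. -/
theorem statement1 (U : UniversalPrefixMachine) :
    ∃ c : ℕ, ∀ (n : ℕ) (S : Finset BStr), (∀ x ∈ S, x.length = n) →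
      ∀ (d : ℕ) (P : Finset BStr), P ⊆ S →
        (1 - (2 : ℝ) ^ (-(d : ℤ))) * (S.card : ℝ) ≤ (P.card : ℝ) →
        ∀ x ∈ S, U.deficiency x S ≤ (d : ℝ) - (U.KsetCond P S : ℝ) - (c : ℝ) → x ∈ P := by
  obtain ⟨c, hc⟩ := DefProof.main_bound U
  refine ⟨c + 2, ?_⟩
  intro n S _ d P hPS hcard x hxS hdef
  by_contra hxP
  obtain ⟨L, hL, hK⟩ := hc S P x hxS hxP
  have hSpos : (0 : ℝ) < S.card := by
    exact_mod_cast Finset.card_pos.2 ⟨x, hxS⟩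
  have hD : ((S \ P).card : ℝ) = S.card - P.card := by
    rw [Finset.cast_card_sdiff hPS]
  have hL' : (2 : ℝ) ^ L ≤ 2 * (S.card - P.card) := by
    rw [← hD]; exact_mod_cast hL
  have h2 : (2 : ℝ) ^ L ≤ 2 * ((2 : ℝ) ^ (-(d : ℤ)) * S.card) := by linarith
  have h3 : (2 : ℝ) ^ (L + d) ≤ 2 * S.card := by
    have hd : (0 : ℝ) < 2 ^ d := by positivity
    rw [zpow_neg, zpow_natCast] at h2
    calc (2 : ℝ) ^ (L + d) = 2 ^ L * 2 ^ d := pow_add _ _ _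
      _ ≤ 2 * ((2 ^ d)⁻¹ * S.card) * 2 ^ d := by gcongr
      _ = 2 * S.card := by field_simp
  have h4 : (L : ℝ) + d ≤ 1 + Real.logb 2 S.card := by
    have := Real.logb_le_logb_of_le (b := 2) (by norm_num) (by positivity) h3
    rw [Real.logb_mul (by norm_num) hSpos.ne', Real.logb_self_eq_one (by norm_num),
      Real.logb_pow, Real.logb_self_eq_one (by norm_num)] at this
    push_cast at this
    linarith
  have hK' : (U.KcS x S : ℝ) ≤ c + U.KsetCond P S + L := by exact_mod_cast hK
  unfold UniversalPrefixMachine.deficiency at hdef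
  push_cast at hdef
  linarith
end

section
/- There is a constant c such that for every binary string x and all natural numbers i1 < i2 ≤ K(x): h_x(i2) + i2 ≤ h_x(i1) + i1 + K(i2 | i1) + c. In other words, up to additive conditional-complexity terms the function h_x(i) + i is non-increasing on [0, K(x)]. -/
open scoped Classical

section Aux
open Encodable

/-- Order on strings used by the canonical listing of finite sets. -/
def EncLe (a b : BStr) : Prop := encode a ≤ encode b

instance : DecidableRel EncLe := fun a b => inferInstanceAs (Decidable (encode a ≤ encode b))
instance : IsTrans BStr EncLe := ⟨fun _ _ _ h h' => le_trans (α := ℕ) h h'⟩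
instance : Std.Antisymm EncLe := ⟨fun _ _ h h' => encode_injective (le_antisymm (α := ℕ) h h')⟩
instance : Std.Total EncLe := ⟨fun a b => le_total (encode a) (encode b)⟩

/-- The finite set listed by a duplicate-free list. -/
def mkS (l : List BStr) (nd : l.Nodup) : Finset BStr := ⟨(l : Multiset BStr), Multiset.coe_nodup.2 nd⟩

theorem mem_mkS (l : List BStr) (nd : l.Nodup) (x : BStr) : x ∈ mkS l nd ↔ x ∈ l := Iff.rfl

theorem encode_sorted (l : List BStr) (nd : l.Nodup) (hl : l.Pairwise EncLe) :
    encode (mkS l nd) = encode l := by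
  change encode (List.mergeSort l fun a b => decide (EncLe a b)) = encode l
  rw [List.mergeSort_eq_self EncLe hl]

theorem exists_listing (S : Finset BStr) : ∃ (l : List BStr) (nd : l.Nodup),
    l.Pairwise EncLe ∧ S = mkS l nd := by
  refine ⟨S.sort EncLe, Finset.sort_nodup .., Finset.pairwise_sort .., ?_⟩
  ext a
  rw [mem_mkS, Finset.mem_sort]

/-- Value of a bit string, least significant bit first. -/
def bval (b : BStr) : ℕ := b.foldr (fun x n => (if x then 1 else 0) + 2 * n) 0

theorem bval_cons (x : Bool) (b : BStr) : bval (x :: b) = (if x then 1 else 0) + 2 * bval b := rfl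

theorem bval_bits (n : ℕ) : bval n.bits = n := by
  induction n using Nat.binaryRec' with
  | zero => rfl
  | bit b n h ih =>
    rw [Nat.bits_append_bit _ _ h, bval_cons, ih]
    cases b <;> (simp [Nat.bit]; try omega)

theorem bval_append_zeros (b : BStr) (r : ℕ) : bval (b ++ List.replicate r false) = bval b := by
  induction b with
  | nil =>
    induction r with
    | zero => rfl
    | succ r ih => 
      simp only [List.nil_append, List.replicate_succ, bval_cons] at ih ⊢
      rw [ih]; rfl
  | cons x b ih => simp [bval_cons, ih]

theorem exists_bval (m j : ℕ) (h : j < 2 ^ m) : ∃ b : BStr, b.length = m ∧ bval b = j := by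
  have hs : j.size ≤ m := Nat.size_le.2 h
  refine ⟨j.bits ++ List.replicate (m - j.size) false, ?_, ?_⟩
  · simp [Nat.size_eq_bits_len, hs]
  · rw [bval_append_zeros, bval_bits]

theorem primrec_bval : Primrec bval := by
  unfold bval
  refine Primrec.list_foldr (h := fun _ (p : Bool × ℕ) => (if p.1 then 1 else 0) + 2 * p.2)
    Primrec.id (Primrec.const 0) ?_
  refine Primrec.nat_add.comp (Primrec.ite (Primrec.eq.comp (Primrec.fst.comp Primrec.snd) (Primrec.const true)) (Primrec.const 1) (Primrec.const 0))
    (Primrec.nat_mul.comp (Primrec.const 2) (Primrec.snd.comp Primrec.snd))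

theorem primrec_bits : Primrec Nat.bits := by
  have : Primrec₂ (fun (_ : Unit) (n : ℕ) => n.bits) := by
    refine Primrec.nat_strong_rec _
      (g := fun _ l => if l.length = 0 then some [] else
        (l[l.length / 2]?).map (fun t => Nat.bodd l.length :: t)) ?_ ?_
    · have hl : Primrec (fun p : Unit × List BStr => p.2.length) :=
        Primrec.list_length.comp Primrec.snd
      refine Primrec.ite (Primrec.eq.comp hl (Primrec.const 0)) (Primrec.const _) ?_
      refine Primrec.option_map (Primrec.list_getElem?.comp Primrec.snd
        (Primrec.nat_div.comp hl (Primrec.const 2))) ?_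
      exact Primrec.list_cons.comp (Primrec.nat_bodd.comp (hl.comp Primrec.fst)) Primrec.snd
    · intro _ n
      rcases Nat.eq_zero_or_pos n with rfl | hn
      · simp
      · have h2 : n / 2 < n := by omega
        have h3 : n.bits = n.bodd :: (n / 2).bits := by
          rw [← Nat.div2_val]
          conv_lhs => rw [← Nat.bit_bodd_div2 n]
          apply Nat.bits_append_bit
          intro h0
          have := Nat.bodd_add_div2 n
          cases hb : n.bodd <;> simp_all
        simp [hn.ne', h2, h3]
  exact this.comp (Primrec.const ()) Primrec.id

theorem primrec_code {α : Type} [Primcodable α] : Primrec (code : α → BStr) :=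
  primrec_bits.comp Primrec.encode

theorem primrec_two_pow : Primrec (fun m : ℕ => 2 ^ m) := by
  have : Primrec (fun m : ℕ => (fun n => 2 * n)^[m] 1) :=
    Primrec.nat_iterate Primrec.id (Primrec.const 1) (Primrec.nat_double.comp Primrec.snd)
  refine this.of_eq fun m => ?_
  induction m with
  | zero => rfl
  | succ m ih => rw [Function.iterate_succ_apply', ih]; ring

/-- Computable stage-wise approximations of a partial recursive function. -/
theorem exists_approx {α σ : Type} [Primcodable α] [Primcodable σ] {f : α →. σ} (hf : Partrec f) :
    ∃ u : ℕ → α → Option σ, Primrec₂ u ∧ (∀ a z, z ∈ f a ↔ ∃ k, u k a = some z) ∧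
      ∀ a z k k', k ≤ k' → u k a = some z → u k' a = some z := by
  obtain ⟨c, hc⟩ := Nat.Partrec.Code.exists_code.1 hf
  refine ⟨fun k a => (Nat.Partrec.Code.evaln k c (encode a)).bind decode, ?_, ?_, ?_⟩
  · refine Primrec.option_bind ?_ (Primrec.decode.comp Primrec.snd)
    exact Nat.Partrec.Code.primrec_evaln.comp
      (Primrec.pair (Primrec.pair Primrec.fst (Primrec.const c)) (Primrec.encode.comp Primrec.snd))
  · intro a z
    have key : ∀ n, n ∈ c.eval (encode a) ↔ ∃ z ∈ f a, encode z = n := by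
      intro n; rw [hc]; simp
    constructor
    · intro hz
      obtain ⟨k, hk⟩ := Nat.Partrec.Code.evaln_complete.1 ((key _).2 ⟨z, hz, rfl⟩)
      exact ⟨k, by simp [Option.mem_def.1 hk]⟩
    · rintro ⟨k, hk⟩
      obtain ⟨n, hn, hd⟩ := Option.bind_eq_some_iff.1 hk
      obtain ⟨z', hz', rfl⟩ := (key _).1 (Nat.Partrec.Code.evaln_sound hn)
      simp at hd
      exact hd ▸ hz'
  · intro a z k k' hkk h
    obtain ⟨n, hn, hd⟩ := Option.bind_eq_some_iff.1 h
    exact Option.bind_eq_some_iff.2 ⟨n, Nat.Partrec.Code.evaln_mono hkk hn, hd⟩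

/-- A computable, prefix-free family of (program, output) pairs bounds complexity. -/
theorem exists_bound (U : UniversalPrefixMachine) {W : Type} [Primcodable W]
    (F : W → Option (BStr × BStr)) (hF : Primrec F)
    (hpf : ∀ w w' P o P' o', F w = some (P, o) → F w' = some (P', o') → P <+: P' →
      P = P' ∧ o = o') :
    ∃ c : ℕ, ∀ w P o, F w = some (P, o) → U.K o ≤ P.length + c := by
  let f : BStr × BStr → ℕ → Option BStr := fun P n =>
    (((decode n : Option W).bind F).bind fun r => if r.1 = P.1 then some r.2 else none)
  have hf : Primrec₂ f := by
    refine Primrec.option_bind (Primrec.option_bind (Primrec.decode.comp Primrec.snd)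
      (hF.comp Primrec.snd)) ?_
    refine Primrec.ite (Primrec.eq.comp (Primrec.fst.comp Primrec.snd)
      (Primrec.fst.comp (Primrec.fst.comp Primrec.fst)))
      (Primrec.option_some.comp (Primrec.snd.comp Primrec.snd)) (Primrec.const none)
  have hspec : ∀ P n o, f P n = some o → ∃ w, F w = some (P.1, o) := by
    intro P n o h
    obtain ⟨r, hr, h⟩ := Option.bind_eq_some_iff.1 h
    obtain ⟨w, _, hw⟩ := Option.bind_eq_some_iff.1 hr
    split_ifs at h with he
    simp at h
    exact ⟨w, by rw [hw, ← he, ← h]⟩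
  let M : PrefixMachine :=
    { eval := fun P y => Nat.rfindOpt (f (P, y))
      partrec' := Partrec.rfindOpt hf.to_comp
      prefixFree := by
        intro y p q hp hq hpq
        obtain ⟨n, a, h⟩ := Nat.rfindOpt_dom.1 hp
        obtain ⟨n', a', h'⟩ := Nat.rfindOpt_dom.1 hq
        obtain ⟨w, hw⟩ := hspec _ _ _ h
        obtain ⟨w', hw'⟩ := hspec _ _ _ h'
        exact (hpf _ _ _ _ _ _ hw hw' hpq).1 }
  obtain ⟨s, hs⟩ := U.universal M
  refine ⟨s.length, fun w P o h => ?_⟩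
  have hd : (Nat.rfindOpt (f (P, []))).Dom :=
    Nat.rfindOpt_dom.2 ⟨encode w, o, by simp [f, h]⟩
  have hm : o ∈ M.eval P [] := by
    obtain ⟨a, ha⟩ := Part.dom_iff_mem.1 hd
    obtain ⟨n, hn⟩ := Nat.rfindOpt_spec ha
    obtain ⟨w', hw'⟩ := hspec _ _ _ hn
    have := (hpf _ _ _ _ _ _ h hw' List.prefix_rfl).2
    exact this ▸ ha
  rw [← hs] at hm
  have h1 : U.K o ≤ (s ++ P).length := Nat.sInf_le ⟨s ++ P, rfl, hm⟩
  rw [List.length_append] at h1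
  omega

theorem exists_program (U : UniversalPrefixMachine) (x y : BStr) :
    ∃ p : BStr, p.length = U.Kc x y ∧ x ∈ U.eval p y := by
  have : {n | ∃ p : BStr, p.length = n ∧ x ∈ U.eval p y}.Nonempty := by
    let M : PrefixMachine :=
      { eval := fun p _ => if p = [] then Part.some x else Part.none
        partrec' := by
          have h : Primrec (fun p : BStr × BStr => if p.1 = [] then some x else none) :=
            Primrec.ite (Primrec.eq.comp Primrec.fst (Primrec.const [])) (Primrec.const _)
              (Primrec.const _)
          refine (Computable.ofOption h.to_comp).of_eq fun p => ?_
          split_ifs <;> simp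
        prefixFree := by
          intro y p q hp hq _
          split_ifs at hp hq with h1 h2
          · rw [h1, h2]
          · exact absurd hq id
          · exact absurd hp id
          · exact absurd hp id }
    obtain ⟨s, hs⟩ := U.universal M
    exact ⟨_, s ++ [], rfl, by rw [hs]; simp [M]⟩
  exact Nat.sInf_mem this


theorem append_prefix_split {X Y X' Y' : BStr} (h : X ++ Y <+: X' ++ Y')
    (hpf : X <+: X' ∨ X' <+: X → X = X') : X = X' ∧ Y <+: Y' := by
  have h1 : X <+: X' ++ Y' := (List.prefix_append X Y).trans h
  have h2 := hpf (List.prefix_or_prefix_of_prefix h1 (List.prefix_append X' Y'))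
  subst h2
  exact ⟨rfl, (List.prefix_append_right_inj X).1 h⟩

theorem unary_prefix_split {c c' : ℕ} {Y Y' : BStr}
    (h : List.replicate c true ++ false :: Y <+: List.replicate c' true ++ false :: Y') :
    c = c' ∧ Y <+: Y' := by
  induction c generalizing c' with
  | zero =>
    cases c' with
    | zero => simpa using h
    | succ c' => simp [List.replicate_succ] at h
  | succ c ih =>
    cases c' with
    | zero => simp [List.replicate_succ] at h
    | succ c' =>
      simp only [List.replicate_succ, List.cons_append, List.cons_prefix_cons, true_and] at h
      obtain ⟨h1, h2⟩ := ih h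
      exact ⟨by rw [h1], h2⟩

/-- Decode a listing of a finite set. -/
def lst (s : BStr) : List BStr := (decode (bval s) : Option (List BStr)).getD []

theorem primrec_lst : Primrec lst :=
  Primrec.option_getD.comp (Primrec.decode.comp primrec_bval) (Primrec.const [])

theorem lst_code (l : List BStr) (nd : l.Nodup) (hl : l.Pairwise EncLe) :
    lst (code (mkS l nd)) = l := by
  unfold lst code
  rw [bval_bits, encode_sorted l nd hl]
  simp

/-- The `j`-th of the `2 ^ m` blocks of a list. -/
def blk (l : List BStr) (m j : ℕ) : List BStr :=
  (l.drop (j * (l.length / 2 ^ m + 1))).take (l.length / 2 ^ m + 1)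

theorem primrec_blk : Primrec (fun a : List BStr × ℕ × ℕ => blk a.1 a.2.1 a.2.2) := by
  have hk : Primrec (fun a : List BStr × ℕ × ℕ => a.1.length / 2 ^ a.2.1 + 1) :=
    Primrec.nat_add.comp (Primrec.nat_div.comp (Primrec.list_length.comp Primrec.fst)
      (primrec_two_pow.comp (Primrec.fst.comp Primrec.snd))) (Primrec.const 1)
  exact Primrec.list_take.comp hk (Primrec.list_drop.comp
    (Primrec.nat_mul.comp (Primrec.snd.comp Primrec.snd) hk) Primrec.fst)

theorem exists_blk (l : List BStr) (m : ℕ) (x : BStr) (hx : x ∈ l) :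
    ∃ j < 2 ^ m, x ∈ blk l m j := by
  obtain ⟨i, hi, rfl⟩ := List.mem_iff_getElem.1 hx
  have hk : 0 < l.length / 2 ^ m + 1 := Nat.succ_pos _
  refine ⟨i / (l.length / 2 ^ m + 1), ?_, ?_⟩
  · rw [Nat.div_lt_iff_lt_mul hk, mul_comm]
    have h := Nat.div_add_mod l.length (2 ^ m)
    have h' := Nat.mod_lt l.length (Nat.two_pow_pos m)
    nlinarith
  · unfold blk
    generalize l.length / 2 ^ m + 1 = k at hk
    have h := Nat.div_add_mod i k
    have h' := Nat.mod_lt i hk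
    rw [List.mem_iff_getElem?]
    refine ⟨i % k, ?_⟩
    rw [List.getElem?_take_of_lt h', List.getElem?_drop, mul_comm, h, List.getElem?_eq_getElem hi]

theorem exists_bound_elem (U : UniversalPrefixMachine) :
    ∃ c : ℕ, ∀ (S : Finset BStr) (x : BStr), x ∈ S →
      U.K x ≤ U.Kset S + S.card.size + c := by
  obtain ⟨u, hu, hus, hum⟩ := exists_approx U.partrec'
  let F : ℕ × BStr × BStr → Option (BStr × BStr) := fun a =>
    (u a.1 (a.2.1, [])).bind fun s =>
      if a.2.2.length = (lst s).length.bits.length then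
        ((lst s)[bval a.2.2]?).map fun o => (a.2.1 ++ a.2.2, o) else none
  have hF : Primrec F := by
    have hp : Primrec (fun a : ℕ × BStr × BStr => a.2.1) := Primrec.fst.comp Primrec.snd
    have hb : Primrec (fun a : ℕ × BStr × BStr => a.2.2) := Primrec.snd.comp Primrec.snd
    refine Primrec.option_bind (hu.comp Primrec.fst (hp.pair (Primrec.const []))) ?_
    have hl : Primrec (fun a : (ℕ × BStr × BStr) × BStr => lst a.2) :=
      primrec_lst.comp Primrec.snd
    refine Primrec.ite (Primrec.eq.comp (Primrec.list_length.comp (hb.comp Primrec.fst))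
      (Primrec.list_length.comp (primrec_bits.comp (Primrec.list_length.comp hl)))) ?_
      (Primrec.const none)
    refine Primrec.option_map (Primrec.list_getElem?.comp hl
      (primrec_bval.comp (hb.comp Primrec.fst))) ?_
    exact Primrec.pair (Primrec.list_append.comp (hp.comp (Primrec.fst.comp Primrec.fst))
      (hb.comp (Primrec.fst.comp Primrec.fst))) Primrec.snd
  have hFs : ∀ k p b P o, F (k, p, b) = some (P, o) ↔ ∃ s, u k (p, []) = some s ∧
      b.length = (lst s).length.bits.length ∧ (lst s)[bval b]? = some o ∧ p ++ b = P := by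
    intro k p b P o
    simp only [F, Option.bind_eq_some_iff]
    refine exists_congr fun s => and_congr_right fun _ => ?_
    split_ifs with h
    · simp [h]
    · simp [h]
  obtain ⟨c, hc⟩ := exists_bound U F hF (by
    rintro ⟨k, p, b⟩ ⟨k', p', b'⟩ P o P' o' h h' hP
    obtain ⟨s, h1, h2, h3, rfl⟩ := (hFs _ _ _ _ _).1 h
    obtain ⟨s', h1', h2', h3', rfl⟩ := (hFs _ _ _ _ _).1 h'
    have m1 := (hus _ _).2 ⟨k, h1⟩
    have m1' := (hus _ _).2 ⟨k', h1'⟩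
    obtain ⟨rfl, hb⟩ := append_prefix_split hP (by
      rintro (hh | hh)
      · exact U.prefixFree [] _ _ (Part.dom_iff_mem.2 ⟨_, m1⟩) (Part.dom_iff_mem.2 ⟨_, m1'⟩) hh
      · exact (U.prefixFree [] _ _ (Part.dom_iff_mem.2 ⟨_, m1'⟩)
          (Part.dom_iff_mem.2 ⟨_, m1⟩) hh).symm)
    obtain rfl := Part.mem_unique m1 m1'
    obtain rfl := hb.eq_of_length (h2.trans h2'.symm)
    rw [h3] at h3'
    exact ⟨rfl, by simpa using h3'⟩)
  refine ⟨c, fun S x hx => ?_⟩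
  obtain ⟨l, nd, hl, rfl⟩ := exists_listing S
  obtain ⟨p, hp, hpe⟩ := exists_program U (code (mkS l nd)) []
  obtain ⟨k, hk⟩ := (hus (p, []) _).1 hpe
  have hx' : x ∈ l := (mem_mkS _ _ _).1 hx
  obtain ⟨i, hi, hix⟩ := List.mem_iff_getElem.1 hx'
  obtain ⟨b, hb, hbi⟩ := exists_bval l.length.size i (hi.trans (Nat.lt_size_self _))
  have := hc (k, p, b) (p ++ b) x ((hFs _ _ _ _ _).2 ⟨_, hk, by
    rw [lst_code l nd hl, hb, Nat.size_eq_bits_len], by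
    rw [lst_code l nd hl, hbi, List.getElem?_eq_getElem hi, hix], rfl⟩)
  rw [List.length_append, hb, hp] at this
  exact this

theorem exists_bound_blk (U : UniversalPrefixMachine) :
    ∃ c : ℕ, ∀ (l : List BStr) (nd : l.Nodup) (_ : l.Pairwise EncLe) (i1 i2 j : ℕ),
      U.Kset (mkS l nd) ≤ i1 → i1 + U.KnatCond i2 i1 + (2 * c + 2) ≤ i2 →
      j < 2 ^ (i2 - i1 - U.KnatCond i2 i1 - (2 * c + 2)) →
      U.K (code (blk l (i2 - i1 - U.KnatCond i2 i1 - (2 * c + 2)) j)) ≤ i2 := by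
  obtain ⟨u, hu, hus, hum⟩ := exists_approx U.partrec'
  let F : ℕ × BStr × ℕ × ℕ × BStr × BStr → Option (BStr × BStr) := fun a =>
    (u a.1 (a.2.1, [])).bind fun s =>
    (u a.1 (a.2.2.2.2.1, code (a.2.1.length + a.2.2.2.1))).bind fun t =>
      if a.2.2.2.2.2.length = bval t - (a.2.1.length + a.2.2.2.1) - a.2.2.2.2.1.length
          - (2 * a.2.2.1 + 2) then
        some (a.2.1 ++ (List.replicate a.2.2.1 true ++ false :: (List.replicate a.2.2.2.1 true ++
            false :: (a.2.2.2.2.1 ++ a.2.2.2.2.2))),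
          code (blk (lst s) a.2.2.2.2.2.length (bval a.2.2.2.2.2)))
      else none
  have hrep : Primrec (fun n : ℕ => List.replicate n true) := by
    refine (Primrec.list_map Primrec.list_range
      (g := fun _ _ => true) (Primrec.const true)).of_eq fun n => ?_
    simp
  have hF : Primrec F := by
    have hp : Primrec (fun a : ℕ × BStr × ℕ × ℕ × BStr × BStr => a.2.1) :=
      Primrec.fst.comp Primrec.snd
    have h2 : Primrec (fun a : ℕ × BStr × ℕ × ℕ × BStr × BStr => a.2.2) :=
      Primrec.snd.comp Primrec.snd
    have hc := Primrec.fst.comp h2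
    have h3 := Primrec.snd.comp h2
    have hd := Primrec.fst.comp h3
    have h4 := Primrec.snd.comp h3
    have hq := Primrec.fst.comp h4
    have hb := Primrec.snd.comp h4
    have hi := Primrec.nat_add.comp (Primrec.list_length.comp hp) hd
    refine Primrec.option_bind (hu.comp Primrec.fst (hp.pair (Primrec.const []))) ?_
    refine Primrec.option_bind ((hu.comp Primrec.fst (hq.pair
      (primrec_code.comp hi))).comp Primrec.fst) ?_
    have hs : Primrec (fun a : ((ℕ × BStr × ℕ × ℕ × BStr × BStr) × BStr) × BStr => a.1.2) :=
      Primrec.snd.comp Primrec.fst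
    have ha : Primrec (fun a : ((ℕ × BStr × ℕ × ℕ × BStr × BStr) × BStr) × BStr => a.1.1) :=
      Primrec.fst.comp Primrec.fst
    refine Primrec.ite (Primrec.eq.comp ((Primrec.list_length.comp hb).comp ha) ?_) ?_
      (Primrec.const none)
    · refine Primrec.nat_sub.comp (Primrec.nat_sub.comp (Primrec.nat_sub.comp
        (primrec_bval.comp Primrec.snd) (hi.comp ha)) ((Primrec.list_length.comp hq).comp ha)) ?_
      exact Primrec.nat_add.comp (Primrec.nat_double.comp (hc.comp ha)) (Primrec.const 2)
    · refine Primrec.option_some.comp (Primrec.pair ?_ ?_)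
      · exact (Primrec.list_append.comp hp (Primrec.list_append.comp (hrep.comp hc)
          (Primrec.list_cons.comp (Primrec.const false) (Primrec.list_append.comp (hrep.comp hd)
          (Primrec.list_cons.comp (Primrec.const false) (Primrec.list_append.comp hq hb)))))).comp ha
      · exact primrec_code.comp (primrec_blk.comp ((primrec_lst.comp hs).pair
          (((Primrec.list_length.comp hb).comp ha).pair ((primrec_bval.comp hb).comp ha))))
  have hFs : ∀ k p c d q b P o, F (k, p, c, d, q, b) = some (P, o) ↔ ∃ s t,
      u k (p, []) = some s ∧ u k (q, code (p.length + d)) = some t ∧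
      b.length = bval t - (p.length + d) - q.length - (2 * c + 2) ∧
      p ++ (List.replicate c true ++ false :: (List.replicate d true ++
            false :: (q ++ b))) = P ∧ code (blk (lst s) b.length (bval b)) = o := by
    intro k p c d q b P o
    simp only [F, Option.bind_eq_some_iff]
    refine exists_congr fun s => ?_
    rw [← exists_and_left]
    refine exists_congr fun t => and_congr_right fun _ => and_congr_right fun _ => ?_
    split_ifs with h
    · simp only [Option.some.injEq, Prod.mk.injEq, h, true_and]
    · simp [h]
  have upf : ∀ y k k' p p' s s', u k (p, y) = some s → u k' (p', y) = some s' →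
      p <+: p' ∨ p' <+: p → p = p' := by
    intro y k k' p p' s s' h1 h1' hh
    have m1 := (hus _ _).2 ⟨k, h1⟩
    have m1' := (hus _ _).2 ⟨k', h1'⟩
    rcases hh with hh | hh
    · exact U.prefixFree y _ _ (Part.dom_iff_mem.2 ⟨_, m1⟩) (Part.dom_iff_mem.2 ⟨_, m1'⟩) hh
    · exact (U.prefixFree y _ _ (Part.dom_iff_mem.2 ⟨_, m1'⟩)
          (Part.dom_iff_mem.2 ⟨_, m1⟩) hh).symm
  obtain ⟨c, hc⟩ := exists_bound U F hF (by
    rintro ⟨k, p, c, d, q, b⟩ ⟨k', p', c', d', q', b'⟩ P o P' o' h h' hP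
    obtain ⟨s, t, h1, h2, h3, rfl, rfl⟩ := (hFs _ _ _ _ _ _ _ _).1 h
    obtain ⟨s', t', h1', h2', h3', rfl, rfl⟩ := (hFs _ _ _ _ _ _ _ _).1 h'
    obtain ⟨rfl, hP1⟩ := append_prefix_split hP (upf _ _ _ _ _ _ _ h1 h1')
    obtain ⟨rfl, hP2⟩ := unary_prefix_split hP1
    obtain ⟨rfl, hP3⟩ := unary_prefix_split hP2
    obtain ⟨rfl, hP4⟩ := append_prefix_split hP3 (upf _ _ _ _ _ _ _ h2 h2')
    obtain rfl := Part.mem_unique ((hus _ _).2 ⟨k, h1⟩) ((hus _ _).2 ⟨k', h1'⟩)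
    obtain rfl := Part.mem_unique ((hus _ _).2 ⟨k, h2⟩) ((hus _ _).2 ⟨k', h2'⟩)
    obtain rfl := hP4.eq_of_length (h3.trans h3'.symm)
    exact ⟨rfl, rfl⟩)
  refine ⟨c, fun l nd hl i1 i2 j hi1 hi2 hj => ?_⟩
  obtain ⟨p, hp, hpe⟩ := exists_program U (code (mkS l nd)) []
  obtain ⟨q, hq, hqe⟩ := exists_program U (code i2) (code i1)
  obtain ⟨b, hb, hbj⟩ := exists_bval _ _ hj
  obtain ⟨k1, hk1⟩ := (hus (p, []) _).1 hpe
  obtain ⟨k2, hk2⟩ := (hus (q, code i1) _).1 hqe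
  have hk1' := hum _ _ _ _ (le_max_left k1 k2) hk1
  have hk2' := hum _ _ _ _ (le_max_right k1 k2) hk2
  change p.length = U.Kset (mkS l nd) at hp
  change q.length = U.KnatCond i2 i1 at hq
  have hd : p.length + (i1 - p.length) = i1 := by omega
  have hbv : bval (code i2) = i2 := by simp [code, bval_bits]
  have := hc (max k1 k2, p, c, i1 - p.length, q, b) _ _ ((hFs _ _ _ _ _ _ _ _).2
    ⟨_, _, hk1', by rw [hd]; exact hk2', by rw [hd, hbv, hb, hq], rfl, rfl⟩)
  rw [lst_code l nd hl, hb, hbj] at this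
  refine this.trans ?_
  simp only [List.length_append, List.length_cons, List.length_replicate, hb]
  omega

theorem blk_set (l : List BStr) (nd : l.Nodup) (hl : l.Pairwise EncLe) (m j : ℕ) :
    ∃ S : Finset BStr, code S = code (blk l m j) ∧ (∀ x, x ∈ S ↔ x ∈ blk l m j) ∧
      S.card ≤ l.length / 2 ^ m + 1 := by
  have hsub : (blk l m j).Sublist l := (List.take_sublist _ _).trans (List.drop_sublist _ _)
  refine ⟨mkS (blk l m j) (nd.sublist hsub), ?_, fun _ => Iff.rfl, ?_⟩
  · unfold code
    rw [encode_sorted _ _ (hl.sublist hsub)]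
  · change (blk l m j).length ≤ _
    exact List.length_take_le _ _

theorem main_real (U : UniversalPrefixMachine) :
    ∃ c : ℕ, ∀ (x : BStr) (i1 i2 : ℕ), i1 < i2 → i2 ≤ U.K x → ∀ S : Finset BStr, x ∈ S →
      U.Kset S ≤ i1 → ∃ S' : Finset BStr, x ∈ S' ∧ U.Kset S' ≤ i2 ∧
      Real.logb 2 S'.card + i2 ≤ Real.logb 2 S.card + i1 + U.KnatCond i2 i1 + c := by
  obtain ⟨c1, hc1⟩ := exists_bound_blk U
  obtain ⟨c2, hc2⟩ := exists_bound_elem U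
  refine ⟨2 * c1 + 2 + 1 + c2, fun x i1 i2 h12 hiK S hx hS => ?_⟩
  by_cases hcase : i1 + U.KnatCond i2 i1 + (2 * c1 + 2) ≤ i2
  swap
  · refine ⟨S, hx, by omega, ?_⟩
    have : (i2 : ℝ) ≤ i1 + U.KnatCond i2 i1 + (2 * c1 + 2 + 1 + c2 : ℕ) := by
      exact_mod_cast (by omega)
    linarith
  have hcard : 0 < S.card := Finset.card_pos.2 ⟨x, hx⟩
  have hcardR : (1 : ℝ) ≤ S.card := by exact_mod_cast hcard
  have hx2 := hc2 S x hx
  obtain ⟨l, nd, hl, rfl⟩ := exists_listing S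
  have hlen : (mkS l nd).card = l.length := rfl
  rw [hlen] at hcard hcardR hx2 ⊢
  set m := i2 - i1 - U.KnatCond i2 i1 - (2 * c1 + 2) with hm
  obtain ⟨j, hj, hxj⟩ := exists_blk l m x ((mem_mkS _ _ _).1 hx)
  obtain ⟨S', hS', hmem, hS'c⟩ := blk_set l nd hl m j
  have hS'pos : 0 < S'.card := Finset.card_pos.2 ⟨x, (hmem x).2 hxj⟩
  have hS'posR : (0 : ℝ) < S'.card := by exact_mod_cast hS'pos
  refine ⟨S', (hmem x).2 hxj, ?_, ?_⟩
  · unfold UniversalPrefixMachine.Kset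
    rw [hS']
    exact hc1 l nd hl i1 i2 j hS hcase hj
  push_cast
  by_cases hlt : l.length < 2 ^ m
  · rw [Nat.div_eq_of_lt hlt] at hS'c
    have h1 : S'.card = 1 := by omega
    rw [h1]
    simp only [Nat.cast_one, Real.logb_one]
    have h2 : (2 : ℝ) ^ (l.length.size - 1 : ℕ) ≤ l.length := by
      have : l.length.size - 1 < l.length.size := by
        have := Nat.size_pos.2 hcard
        omega
      exact_mod_cast Nat.lt_size.1 this
    have h3 : ((l.length.size - 1 : ℕ) : ℝ) ≤ Real.logb 2 l.length := by
      rw [Real.le_logb_iff_rpow_le (by norm_num) (by linarith), Real.rpow_natCast]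
      exact h2
    have h4 : (i2 : ℝ) ≤ i1 + ((l.length.size - 1 : ℕ) : ℝ) + 1 + c2 := by
      exact_mod_cast (by omega)
    have h5 : (0 : ℝ) ≤ U.KnatCond i2 i1 := Nat.cast_nonneg _
    have h6 : (0 : ℝ) ≤ c1 := Nat.cast_nonneg _
    linarith
  · have h1 : S'.card * 2 ^ m ≤ 2 * l.length := by
      have h2 := Nat.div_mul_le_self l.length (2 ^ m)
      have h3 := Nat.mul_le_mul_right (2 ^ m) hS'c
      rw [add_mul] at h3
      omega
    have h1R : (S'.card : ℝ) * 2 ^ m ≤ 2 * l.length := by exact_mod_cast h1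
    have h2 := Real.logb_le_logb_of_le (b := 2) (by norm_num) (by positivity) h1R
    rw [Real.logb_mul hS'posR.ne' (by positivity), Real.logb_mul (by norm_num) (by linarith),
      Real.logb_pow, Real.logb_self_eq_one (by norm_num)] at h2
    have h4 : (i2 : ℝ) = i1 + U.KnatCond i2 i1 + (2 * c1 + 2) + m := by
      exact_mod_cast (by omega)
    have h5 : (0 : ℝ) ≤ c2 := Nat.cast_nonneg _
    linarith
end Aux

/-- There is a constant `c` such that for every string `x` and all
`i1 < i2 ≤ K(x)`: `h_x(i2) + i2 ≤ h_x(i1) + i1 + K(i2|i1) + c`. -/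
theorem statement3 (U : UniversalPrefixMachine) :
    ∃ c : ℕ, ∀ (x : BStr) (i1 i2 : ℕ), i1 < i2 → i2 ≤ U.K x →
      U.h x i2 + (((i2 : ℕ) : ℝ) : EReal) ≤
        U.h x i1 + (((i1 : ℕ) : ℝ) : EReal) + (((U.KnatCond i2 i1 : ℕ) : ℝ) : EReal)
          + (((c : ℕ) : ℝ) : EReal) := by
  obtain ⟨c, hc⟩ := main_real U
  refine ⟨c, fun x i1 i2 h12 hiK => ?_⟩
  have key : U.h x i2 + ((((i2 : ℝ) - i1 - U.KnatCond i2 i1 - c : ℝ)) : EReal) ≤ U.h x i1 := by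
    refine le_sInf ?_
    rintro r ⟨S, hx, hS, rfl⟩
    obtain ⟨S', hx', hS', hle⟩ := hc x i1 i2 h12 hiK S hx hS
    have hh : U.h x i2 ≤ ((Real.logb 2 (S'.card : ℝ)) : EReal) :=
      sInf_le ⟨S', hx', hS', rfl⟩
    refine (add_le_add_left hh _).trans ?_
    rw [← EReal.coe_add, EReal.coe_le_coe_iff]
    linarith
  have e : ∀ z : EReal, z + (((i2 : ℕ) : ℝ) : EReal) =
      z + ((((i2 : ℝ) - i1 - U.KnatCond i2 i1 - c : ℝ)) : EReal) + (((i1 : ℕ) : ℝ) : EReal)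
        + (((U.KnatCond i2 i1 : ℕ) : ℝ) : EReal) + (((c : ℕ) : ℝ) : EReal) := by
    intro z
    simp only [add_assoc, ← EReal.coe_add]
    congr 2
    ring
  rw [e]
  gcongr
end

section
/- There is a constant c such that for every n, every k ≤ n, and every non-increasing integer-valued function λ whose domain includes {0,…,k} with λ(0) ≤ n and λ(k) = k, there exists a binary string x of length n whose complexity satisfies |K(x) − k| ≤ K(k,n,λ) + c, and such that λ_x is (ε,δ)-close to λ with ε(i) = δ(i) = K(i,n,λ) + c. -/
open scoped Classical

/-- `K(i,n,λ)`: the minimum length of a program that outputs `i` and `n` and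
computes `λ(j)` given any `j` in the domain `{0,…,k}` of `λ`. -/
noncomputable def KfunInfo (U : UniversalPrefixMachine) (i n k : ℕ) (lam : ℕ → ℕ) : ℕ :=
  sInf {m | ∃ p : BStr, p.length = m ∧ ∀ j ≤ k, code (i, n, lam j) ∈ U.eval p (code j)}


/-! ## Primitive recursion tools -/

namespace VV

open Encodable

section prim
variable {γ β σ : Type} [Primcodable γ] [Primcodable β] [Primcodable σ]

theorem prim_forall_lt {f : γ → ℕ} {P : γ → ℕ → Prop} (hf : Primrec f)
    (hP : PrimrecPred fun x : γ × ℕ => P x.1 x.2) :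
    PrimrecPred fun g => ∀ j < f g, P g j := by
  have hR : PrimrecRel fun (j : ℕ) (g : γ) => P g j :=
    hP.comp (Primrec.snd.pair Primrec.fst)
  have h := PrimrecRel.forall_mem_list hR
  have h2 := h.comp (f := fun g : γ => List.range (f g)) (g := fun g => g)
    (Primrec.list_range.comp hf) Primrec.id
  exact h2.of_eq (by simp)

theorem prim_exists_mem {f : γ → List β} {P : γ → β → Prop} (hf : Primrec f)
    (hP : PrimrecPred fun x : γ × β => P x.1 x.2) :
    PrimrecPred fun g => ∃ b ∈ f g, P g b := by
  have hR : PrimrecRel fun (b : β) (g : γ) => P g b :=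
    hP.comp (Primrec.snd.pair Primrec.fst)
  exact (PrimrecRel.exists_mem_list hR).comp hf Primrec.id

theorem prim_filter {f : γ → List β} {P : γ → β → Prop} [∀ g b, Decidable (P g b)]
    (hf : Primrec f) (hP : PrimrecPred fun x : γ × β => P x.1 x.2) :
    Primrec fun g => (f g).filter (fun b => decide (P g b)) := by
  have hR : PrimrecRel fun (b : β) (g : γ) => P g b :=
    hP.comp (Primrec.snd.pair Primrec.fst)
  let _ : DecidableRel fun (b : β) (g : γ) => P g b := fun b g => inferInstance
  exact (PrimrecRel.listFilter hR).comp hf Primrec.id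

theorem prim_sum {f : γ → List β} {h : γ → β → ℕ} (hf : Primrec f)
    (hh : Primrec fun x : γ × β => h x.1 x.2) :
    Primrec fun g => ((f g).map (h g)).sum := by
  have h1 : Primrec fun g => (f g).foldr (fun b n => h g b + n) 0 := by
    refine Primrec.list_foldr (h := fun g (x : β × ℕ) => h g x.1 + x.2) hf (Primrec.const 0) ?_
    exact Primrec.nat_add.comp
      (hh.comp (Primrec.fst.pair (Primrec.fst.comp Primrec.snd)))
      (Primrec.snd.comp Primrec.snd)
  refine h1.of_eq fun g => ?_
  induction f g with
  | nil => rfl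
  | cons a l ih => simp [ih]

theorem prim_pow2 {f : γ → ℕ} (hf : Primrec f) : Primrec fun g => 2 ^ f g := by
  have h : Primrec fun n : ℕ => 2 ^ n := by
    have := Primrec.nat_rec₁ (f := fun _ r => 2 * r) 1
      (Primrec.nat_mul.comp (Primrec.const 2) Primrec.snd)
    refine this.of_eq fun n => ?_
    induction n with
    | zero => rfl
    | succ n ih => simp only [ih]; ring
  exact h.comp hf

theorem prim_bits : Primrec Nat.bits := by
  have : Primrec₂ (fun (_ : Unit) (n : ℕ) => Nat.bits n) := by
    refine Primrec.nat_strong_rec _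
      (g := fun _ (L : List (List Bool)) =>
        if L.length = 0 then some [] else
          some (Nat.bodd L.length :: L.getD (Nat.div2 L.length) [])) ?_ ?_
    · have hl : Primrec fun x : Unit × List (List Bool) => x.2.length :=
        Primrec.list_length.comp Primrec.snd
      refine Primrec.ite (Primrec.eq.comp hl (Primrec.const 0)) (Primrec.const _) ?_
      refine Primrec.option_some.comp (Primrec.list_cons.comp (Primrec.nat_bodd.comp hl) ?_)
      exact (Primrec.list_getD []).comp Primrec.snd (Primrec.nat_div2.comp hl)
    · intro _ n
      rcases Nat.eq_zero_or_pos n with h | h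
      · subst h; simp
      · have h2 : n.div2 < n := by rw [Nat.div2_val]; omega
        simp only [List.length_map, List.length_range, h.ne', if_false]
        congr 1
        rw [List.getD_eq_getElem?_getD]
        simp only [List.getElem?_map, List.getElem?_range h2, Option.map_some, Option.getD_some]
        conv_rhs => rw [← Nat.bit_bodd_div2 n]
        rw [Nat.bits_append_bit]
        intro h0
        by_contra hb
        have := Nat.bit_bodd_div2 n
        rw [h0] at this
        simp [Bool.eq_false_iff.2 hb] at this
        omega
  exact this.comp (Primrec.const ()) Primrec.id

theorem prim_code {α : Type} [Primcodable α] {f : γ → α} (hf : Primrec f) :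
    Primrec fun g => code (f g) :=
  prim_bits.comp (Primrec.encode.comp hf)

theorem code_inj {α : Type} [Encodable α] {a b : α} (h : code a = code b) : a = b := by
  have h2 : Nat.bits (encode a) = Nat.bits (encode b) := h
  have hinv : Function.LeftInverse (fun l : List Bool => l.foldr Nat.bit 0) Nat.bits := by
    intro n
    induction n using Nat.binaryRec' with
    | zero => simp
    | bit b n hn ih => rw [Nat.bits_append_bit _ _ hn]; simpa using congrArg (Nat.bit b) ih
  exact encode_injective (hinv.injective h2)

theorem prim_decode₂ {α : Type} [Primcodable α] : Primrec (decode₂ α) := by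
  have : Primrec fun n : ℕ => (decode (α := α) n).bind
      (fun a => if encode a = n then some a else none) := by
    refine Primrec.option_bind Primrec.decode ?_
    exact Primrec.ite (Primrec.eq.comp (Primrec.encode.comp Primrec.snd) Primrec.fst)
      (Primrec.option_some.comp Primrec.snd) (Primrec.const none)
  refine this.of_eq fun n => ?_
  ext a
  rw [show decode₂ α n = some a ↔ _ from mem_decode₂']
  simp [Option.bind_eq_some_iff]

end prim

/-- All elements of `α` with code below `t`, in increasing order of codes. -/
def enumL (α : Type) [Encodable α] (t : ℕ) : List α := (List.range t).filterMap (decode₂ α)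

theorem mem_enumL {α : Type} [Encodable α] {t : ℕ} {a : α} :
    a ∈ enumL α t ↔ encode a < t := by
  simp only [enumL, List.mem_filterMap, List.mem_range, decode₂_eq_some]
  constructor
  · rintro ⟨n, h1, h2⟩; omega
  · intro h; exact ⟨_, h, rfl⟩

theorem enumL_sorted {α : Type} [Encodable α] (t : ℕ) :
    (enumL α t).Pairwise (fun a b => encode a < encode b) := by
  rw [enumL, List.pairwise_filterMap]
  refine List.pairwise_lt_range.imp ?_
  intro a b h x hx y hy
  rw [decode₂_eq_some] at hx hy
  omega

theorem enumL_nodup {α : Type} [Encodable α] (t : ℕ) : (enumL α t).Nodup :=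
  (enumL_sorted t).imp (fun h e => by subst e; exact lt_irrefl _ h)

theorem prim_enumL {γ α : Type} [Primcodable γ] [Primcodable α] {t : γ → ℕ} (ht : Primrec t) :
    Primrec fun g => enumL α (t g) :=
  Primrec.listFilterMap (Primrec.list_range.comp ht) (prim_decode₂.comp Primrec.snd)

/-- Bound on codes of strings of length `n`. -/
def strBound : ℕ → ℕ := fun n => Nat.rec 1 (fun _ B => (B + 2) ^ 2 + 2) n

theorem prim_strBound : Primrec strBound := by
  refine Primrec.nat_rec₁ (f := fun _ B => (B + 2) ^ 2 + 2) 1 ?_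
  have h2 : Primrec fun x : ℕ × ℕ => x.2 + 2 := Primrec.nat_add.comp Primrec.snd (Primrec.const 2)
  refine (Primrec.nat_add.comp (Primrec.nat_mul.comp h2 h2) (Primrec.const 2)).of_eq ?_
  intro x; simp only []; ring

theorem encode_lt_strBound (x : BStr) : encode x < strBound x.length := by
  induction x with
  | nil => simp [strBound]
  | cons b l ih =>
    have h1 : strBound (b :: l).length = (strBound l.length + 2) ^ 2 + 2 := rfl
    rw [h1, encode_list_cons]
    have hb : encode b ≤ 1 := by cases b <;> simp
    have h3 := Nat.pair_lt_max_add_one_sq (encode b) (encode l)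
    have h4 : max (encode b) (encode l) + 1 ≤ strBound l.length + 2 := by
      have : max (encode b) (encode l) ≤ strBound l.length + 1 := max_le (by omega) (by omega)
      omega
    have h5 := Nat.pow_le_pow_left h4 2
    simp only [Nat.succ_eq_add_one]
    omega

/-- All strings of length `n`, sorted by code. -/
noncomputable def allStr (n : ℕ) : List BStr :=
  (enumL BStr (strBound n)).filter (fun x => decide (x.length = n))

theorem mem_allStr {n : ℕ} {x : BStr} : x ∈ allStr n ↔ x.length = n := by
  simp only [allStr, List.mem_filter, mem_enumL, decide_eq_true_eq]
  constructor
  · exact fun h => h.2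
  · intro h; subst h; exact ⟨encode_lt_strBound x, rfl⟩

theorem allStr_sorted (n : ℕ) :
    (allStr n).Pairwise (fun a b => encode a < encode b) := (enumL_sorted _).filter _

theorem allStr_nodup (n : ℕ) : (allStr n).Nodup := (enumL_nodup _).filter _

theorem allStr_length (n : ℕ) : (allStr n).length = 2 ^ n := by
  have e : ((allStr n).toFinset : Finset BStr) =
      (Finset.univ : Finset (List.Vector Bool n)).map ⟨fun v => v.1, Subtype.val_injective⟩ := by
    ext x
    simp only [List.mem_toFinset, mem_allStr, Finset.mem_map, Finset.mem_univ, true_and]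
    constructor
    · intro h; exact ⟨⟨x, h⟩, rfl⟩
    · rintro ⟨v, rfl⟩; exact v.2
  have h := List.toFinset_card_of_nodup (allStr_nodup n)
  rw [← h, e, Finset.card_map, Finset.card_univ, card_vector]; simp

theorem prim_allStr {γ : Type} [Primcodable γ] {n : γ → ℕ} (hn : Primrec n) :
    Primrec fun g => allStr (n g) :=
  prim_filter (P := fun g (x : BStr) => x.length = n g) (prim_enumL (prim_strBound.comp hn))
    (Primrec.eq.comp (f := fun x : γ × BStr => x.2.length)
      (Primrec.list_length.comp Primrec.snd) (hn.comp Primrec.fst))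

/-- Sorted lists encode the same way as the finset of their elements. -/
theorem code_toFinset {l : List BStr} (h : l.Pairwise (fun a b => encode a < encode b)) :
    code (l.toFinset) = code l := by
  have hn : l.Nodup := h.imp (fun h e => by subst e; exact lt_irrefl _ h)
  have : encode (l.toFinset) = encode l := by
    obtain ⟨r, i1, i2, i3, i4, hr, e⟩ : ∃ (r : BStr → BStr → Prop) (i1 : DecidableRel r)
        (i2 : IsTrans BStr r) (i3 : Std.Antisymm r) (i4 : Std.Total r),
        (∀ a b, r a b ↔ encode a ≤ encode b) ∧
        encode l.toFinset = encode (Multiset.sort l.toFinset.val r) :=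
      ⟨_, _, _, _, _, fun _ _ => Iff.rfl, rfl⟩
    rw [e]
    congr 1
    have hv : l.toFinset.val = (l : Multiset BStr) := by
      rw [List.toFinset_val, hn.dedup]
    rw [hv, Multiset.coe_sort]
    refine List.mergeSort_eq_self _ ?_
    refine h.imp ?_
    intro a b hab
    simpa [hr] using hab.le
  simp only [code, this]

end VV

/-! ## Step-bounded simulation and machine construction -/

namespace VV

open Encodable

theorem exists_ucode (U : UniversalPrefixMachine) : ∃ c : Nat.Partrec.Code,
    ∀ p y o, o ∈ U.eval p y ↔ encode o ∈ c.eval (encode (p, y)) := by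
  obtain ⟨c, hc⟩ := Nat.Partrec.Code.exists_code.1 U.partrec'
  refine ⟨c, fun p y o => ?_⟩
  rw [hc]
  simp only [encodek, Part.coe_some, Part.bind_some]
  rw [Part.mem_map_iff]
  constructor
  · intro h; exact ⟨o, h, rfl⟩
  · rintro ⟨o', h, e⟩; rwa [← encode_injective e]

noncomputable def ucode (U : UniversalPrefixMachine) : Nat.Partrec.Code :=
  Classical.choose (exists_ucode U)

/-- `U(p|y)` outputs `o` within `t` steps. -/
def Chk (U : UniversalPrefixMachine) (t : ℕ) (p y o : BStr) : Prop :=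
  Nat.Partrec.Code.evaln t (ucode U) (encode (p, y)) = some (encode o)

variable {U : UniversalPrefixMachine}

theorem chk_spec {p y o : BStr} : o ∈ U.eval p y ↔ ∃ t, Chk U t p y o := by
  rw [Classical.choose_spec (exists_ucode U) p y o, Nat.Partrec.Code.evaln_complete]
  rfl

theorem Chk.mono {t t' : ℕ} {p y o : BStr} (h : Chk U t p y o) (ht : t ≤ t') : Chk U t' p y o :=
  Nat.Partrec.Code.evaln_mono ht h

theorem Chk.mem {t : ℕ} {p y o : BStr} (h : Chk U t p y o) : o ∈ U.eval p y := chk_spec.2 ⟨t, h⟩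

theorem Chk.unique {t t' : ℕ} {p y o o' : BStr} (h : Chk U t p y o) (h' : Chk U t' p y o') :
    o = o' := Part.mem_unique h.mem h'.mem

theorem Chk.prefixFree {t t' : ℕ} {p p' y o o' : BStr} (h : Chk U t p y o)
    (h' : Chk U t' p' y o') (hp : p <+: p') : p = p' :=
  U.prefixFree y p p' (Part.dom_iff_mem.2 ⟨_, h.mem⟩) (Part.dom_iff_mem.2 ⟨_, h'.mem⟩) hp

theorem prim_chk {γ : Type} [Primcodable γ] {t : γ → ℕ} {p y o : γ → BStr} (ht : Primrec t)
    (hp : Primrec p) (hy : Primrec y) (ho : Primrec o) :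
    PrimrecPred fun g => Chk U (t g) (p g) (y g) (o g) := by
  have h1 : Primrec fun g => Nat.Partrec.Code.evaln (t g) (ucode U) (encode (p g, y g)) :=
    Nat.Partrec.Code.primrec_evaln.comp
      ((ht.pair (Primrec.const (ucode U))).pair (Primrec.encode.comp (hp.pair hy)))
  exact Primrec.eq.comp h1 (Primrec.option_some.comp (Primrec.encode.comp ho))

/-- Building a program prefix from a certificate relation. -/
theorem machine (U : UniversalPrefixMachine) {C : Type} [Primcodable C]
    (cond : BStr → BStr → C → Prop) (out : C → BStr)
    (hc : PrimrecPred fun x : (BStr × BStr) × C => cond x.1.1 x.1.2 x.2) (ho : Primrec out)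
    (hpf : ∀ y r r' a a', cond r y a → cond r' y a' → r <+: r' → r = r') :
    ∃ s : BStr, ∀ r y a, cond r y a → ∃ a', cond r y a' ∧ out a' ∈ U.eval (s ++ r) y := by
  let f : BStr × BStr → ℕ → Option BStr := fun x N =>
    (decode (α := C) N).bind fun a => if cond x.1 x.2 a then some (out a) else none
  have hf : Primrec₂ f := by
    refine Primrec.option_bind (Primrec.decode.comp Primrec.snd) ?_
    refine Primrec.ite (c := fun x : ((BStr × BStr) × ℕ) × C => cond x.1.1.1 x.1.1.2 x.2) ?_
      (Primrec.option_some.comp (ho.comp Primrec.snd)) (Primrec.const none)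
    exact hc.comp ((Primrec.fst.comp Primrec.fst).pair Primrec.snd)
  have key : ∀ x o, o ∈ Nat.rfindOpt (f x) → ∃ a, cond x.1 x.2 a ∧ out a = o := by
    intro x o h
    obtain ⟨N, hN⟩ := Nat.rfindOpt_spec h
    simp only [f, Option.mem_def, Option.bind_eq_some_iff] at hN
    obtain ⟨a, -, ha⟩ := hN
    split_ifs at ha with hh
    exact ⟨a, hh, Option.some.inj ha⟩
  let M : PrefixMachine :=
    { eval := fun r y => Nat.rfindOpt (f (r, y))
      partrec' := Partrec.rfindOpt (f := f) hf.to_comp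
      prefixFree := by
        intro y p q hp hq hpq
        obtain ⟨o, ho⟩ := Part.dom_iff_mem.1 hp
        obtain ⟨o', ho'⟩ := Part.dom_iff_mem.1 hq
        obtain ⟨a, ha, -⟩ := key _ _ ho
        obtain ⟨a', ha', -⟩ := key _ _ ho'
        exact hpf _ _ _ _ _ ha ha' hpq }
  obtain ⟨s, hs⟩ := U.universal M
  refine ⟨s, fun r y a ha => ?_⟩
  have hd : (Nat.rfindOpt (f (r, y))).Dom := by
    refine Nat.rfindOpt_dom.2 ⟨encode a, out a, ?_⟩
    simp [f, ha]
  obtain ⟨o, ho⟩ := Part.dom_iff_mem.1 hd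
  obtain ⟨a', ha', e⟩ := key _ _ ho
  refine ⟨a', ha', ?_⟩
  rw [hs, e]
  exact ho

theorem unary_pf {a b : ℕ} {u v : BStr}
    (h : List.replicate a true ++ false :: u <+: List.replicate b true ++ false :: v) :
    a = b ∧ u <+: v := by
  induction a generalizing b with
  | zero =>
    cases b with
    | zero => simpa using h
    | succ b => simp [List.replicate_succ] at h
  | succ a ih =>
    cases b with
    | zero => simp [List.replicate_succ] at h
    | succ b =>
      simp only [List.replicate_succ, List.cons_append, List.cons_prefix_cons, true_and] at h
      obtain ⟨h1, h2⟩ := ih h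
      exact ⟨by omega, h2⟩

theorem prefix_cases {a b m : BStr} (h1 : a <+: m) (h2 : b <+: m) : a <+: b ∨ b <+: a := by
  rcases le_total a.length b.length with h | h
  · exact Or.inl (List.prefix_of_prefix_length_le h1 h2 h)
  · exact Or.inr (List.prefix_of_prefix_length_le h2 h1 h)

/-- The unary self-delimiting prefix. -/
def una (a : ℕ) (u : BStr) : BStr := List.replicate a true ++ false :: u

theorem una_pf {a b : ℕ} {u v : BStr} (h : una a u <+: una b v) : a = b ∧ u <+: v :=
  unary_pf h

theorem una_inj {a b : ℕ} {u v : BStr} (h : una a u = una b v) : a = b :=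
  (una_pf (u := u) (v := v) (by rw [h])).1

theorem una_length (a : ℕ) (u : BStr) : (una a u).length = a + 1 + u.length := by
  simp [una]; omega

theorem prim_una {γ : Type} [Primcodable γ] {a : γ → ℕ} {u : γ → BStr} (ha : Primrec a)
    (hu : Primrec u) : Primrec fun g => una (a g) (u g) := by
  have h1 : Primrec fun g => (List.range (a g)).map (fun _ => true) :=
    Primrec.list_map (Primrec.list_range.comp ha) (Primrec.const true).to₂
  refine (Primrec.list_append.comp h1 (Primrec.list_cons.comp (Primrec.const false) hu)).of_eq ?_
  intro g
  simp [una]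

/-- Every string has a program. -/
theorem exists_prog (U : UniversalPrefixMachine) (o y : BStr) : ∃ p, o ∈ U.eval p y := by
  obtain ⟨s, hs⟩ := machine U (C := BStr) (fun r _ a => r = una (encode a) []) (fun a => a)
    (Primrec.eq.comp (Primrec.fst.comp Primrec.fst)
      (prim_una (Primrec.encode.comp Primrec.snd) (Primrec.const [])))
    Primrec.id
    (by
      intro y r r' a a' h h' hp
      subst h h'
      rw [(una_pf hp).1])
  obtain ⟨a', h1, h2⟩ := hs (una (encode o) []) y o rfl
  have := encode_injective (una_inj h1)
  subst this
  exact ⟨_, h2⟩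

theorem exists_K (U : UniversalPrefixMachine) (x : BStr) :
    ∃ p : BStr, p.length = U.K x ∧ x ∈ U.eval p [] := by
  obtain ⟨p, hp⟩ := exists_prog U x []
  have := Nat.sInf_mem (s := {n | ∃ p : BStr, p.length = n ∧ x ∈ U.eval p []}) ⟨_, p, rfl, hp⟩
  exact this

theorem K_le {x p : BStr} (h : x ∈ U.eval p []) : U.K x ≤ p.length :=
  Nat.sInf_le ⟨p, rfl, h⟩

/-- Simple transformations of outputs cost only a constant number of bits. -/
theorem transform (U : UniversalPrefixMachine) {D : Type} [Primcodable D] (f g : D → BStr)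
    (hf : Primrec f) (hg : Primrec g) (hfg : ∀ a b, f a = f b → g a = g b) :
    ∃ s : BStr, ∀ p y a, f a ∈ U.eval p y → g a ∈ U.eval (s ++ p) y := by
  obtain ⟨s, hs⟩ := machine U (C := ℕ × D) (fun r y a => Chk U a.1 r y (f a.2)) (fun a => g a.2)
    (prim_chk (Primrec.fst.comp Primrec.snd) (Primrec.fst.comp Primrec.fst)
      (Primrec.snd.comp Primrec.fst) (hf.comp (Primrec.snd.comp Primrec.snd)))
    (hg.comp Primrec.snd)
    (by
      intro y r r' a a' h h' hp
      exact h.prefixFree h' hp)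
  refine ⟨s, fun p y a h => ?_⟩
  obtain ⟨t, ht⟩ := chk_spec.1 h
  obtain ⟨a', h1, h2⟩ := hs p y (t, a) ht
  rw [hfg a a'.2 (ht.unique h1)]
  exact h2

theorem code_singleton (x : BStr) : code ({x} : Finset BStr) = code [x] := by
  rw [← code_toFinset (l := [x]) (by simp)]
  simp

theorem Kset_singleton_le (U : UniversalPrefixMachine) :
    ∃ c, ∀ x, U.Kset {x} ≤ U.K x + c := by
  obtain ⟨s, hs⟩ := transform U (D := BStr) (fun x => x) (fun x => code [x]) Primrec.id
    (prim_code (Primrec.list_cons.comp Primrec.id (Primrec.const []))) (by rintro a b rfl; rfl)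
  refine ⟨s.length, fun x => ?_⟩
  obtain ⟨p, hp, h⟩ := exists_K U x
  have := K_le (hs p [] x h)
  rw [UniversalPrefixMachine.Kset, code_singleton]
  simp at this
  omega

theorem K_le_Kset_singleton (U : UniversalPrefixMachine) :
    ∃ c, ∀ x, U.K x ≤ U.Kset {x} + c := by
  obtain ⟨s, hs⟩ := transform U (D := BStr) (fun x => code [x]) (fun x => x)
    (prim_code (Primrec.list_cons.comp Primrec.id (Primrec.const []))) Primrec.id
    (by intro a b h; simpa using code_inj h)
  refine ⟨s.length, fun x => ?_⟩
  obtain ⟨p, hp, h⟩ := exists_K U (code [x])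
  have := K_le (hs p [] x h)
  rw [UniversalPrefixMachine.Kset, code_singleton]
  simp at this
  omega

/-- `p` is a program for `(i,n,λ)` on `{0,…,k}`. -/
def IsProg (U : UniversalPrefixMachine) (i n k : ℕ) (lam : ℕ → ℕ) (p : BStr) : Prop :=
  ∀ j ≤ k, code (i, n, lam j) ∈ U.eval p (code j)

theorem Kfun_le {i n k : ℕ} {lam : ℕ → ℕ} {p : BStr} (h : IsProg U i n k lam p) :
    KfunInfo U i n k lam ≤ p.length := Nat.sInf_le ⟨p, rfl, h⟩

theorem exists_isProg (U : UniversalPrefixMachine) (i n k : ℕ) (lam : ℕ → ℕ) :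
    ∃ p, IsProg U i n k lam p := by
  obtain ⟨s, hs⟩ := machine U (C := (ℕ × ℕ × List ℕ) × ℕ)
    (fun r y a => r = una (encode a.1) [] ∧ y = code a.2)
    (fun a => code (a.1.1, a.1.2.1, a.1.2.2.getD a.2 0))
    (by
      refine PrimrecPred.and ?_ ?_
      · exact Primrec.eq.comp (Primrec.fst.comp Primrec.fst)
          (prim_una (Primrec.encode.comp (Primrec.fst.comp Primrec.snd)) (Primrec.const []))
      · exact Primrec.eq.comp (Primrec.snd.comp Primrec.fst)
          (prim_code (Primrec.snd.comp Primrec.snd)))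
    (by
      refine prim_code ?_
      refine Primrec.pair (Primrec.fst.comp Primrec.fst) (Primrec.pair
        (Primrec.fst.comp (Primrec.snd.comp Primrec.fst)) ?_)
      exact (Primrec.list_getD 0).comp (Primrec.snd.comp (Primrec.snd.comp Primrec.fst))
        Primrec.snd)
    (by
      rintro y r r' a a' ⟨h, -⟩ ⟨h', -⟩ hp
      subst h h'
      rw [(una_pf hp).1])
  refine ⟨s ++ una (encode (i, n, (List.range (k + 1)).map lam)) [], fun j hj => ?_⟩
  obtain ⟨a, ⟨h1, h2⟩, h3⟩ := hs (una (encode (i, n, (List.range (k + 1)).map lam)) []) (code j)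
    ((i, n, (List.range (k + 1)).map lam), j) ⟨rfl, rfl⟩
  have e1 := encode_injective (una_inj h1)
  have e2 := code_inj h2
  rw [← e1, ← e2] at h3
  have : ((List.range (k + 1)).map lam).getD j 0 = lam j := by
    rw [List.getD_eq_getElem?_getD]
    simp [List.getElem?_range (show j < k + 1 by omega)]
  simp only [this] at h3
  exact h3

theorem exists_Kfun (U : UniversalPrefixMachine) (i n k : ℕ) (lam : ℕ → ℕ) :
    ∃ p : BStr, p.length = KfunInfo U i n k lam ∧ IsProg U i n k lam p := by
  obtain ⟨p, hp⟩ := exists_isProg U i n k lam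
  have := Nat.sInf_mem (s := {m | ∃ p : BStr, p.length = m ∧
    ∀ j ≤ k, code (i, n, lam j) ∈ U.eval p (code j)}) ⟨_, p, rfl, hp⟩
  exact this

theorem Kfun_zero_le (U : UniversalPrefixMachine) :
    ∃ c, ∀ i n k lam, KfunInfo U 0 n k lam ≤ KfunInfo U i n k lam + c := by
  obtain ⟨s, hs⟩ := transform U (D := ℕ × ℕ × ℕ) (fun x => code x) (fun x => code (0, x.2))
    (prim_code Primrec.id) (prim_code ((Primrec.const 0).pair Primrec.snd))
    (by intro a b h; rw [code_inj h])
  refine ⟨s.length, fun i n k lam => ?_⟩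
  obtain ⟨p, hp, h⟩ := exists_Kfun U i n k lam
  have := Kfun_le (U := U) (i := 0) (n := n) (k := k) (lam := lam) (p := s ++ p)
    (fun j hj => hs p _ (i, n, lam j) (h j hj))
  simp at this
  omega

end VV

/-! ## Bad sets and windows -/

namespace VV

open Encodable

/-- `r` is verified within `t` steps to be a program for `(i,n,ℓ)`. -/
def Ver (U : UniversalPrefixMachine) (t : ℕ) (r : BStr) (i n : ℕ) (ℓ : List ℕ) : Prop :=
  ∀ j < ℓ.length, Chk U t r (code j) (code (i, n, ℓ.getD j 0))

/-- The program-set pair `a` is seen to be bad at stage `t`. -/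
def BadC (U : UniversalPrefixMachine) (c n : ℕ) (ℓ : List ℕ) (t : ℕ)
    (a : BStr × List BStr) : Prop :=
  a.1.length ≤ ℓ.length - 1 ∧ Chk U t a.1 [] (code a.2) ∧
    ∃ r ∈ enumL BStr t, Ver U t r 0 n ℓ ∧
      2 ^ a.1.length * a.2.length <
        2 ^ (ℓ.getD (min (ℓ.length - 1) (max a.1.length (r.length + c))) 0)

noncomputable def badL (U : UniversalPrefixMachine) (c n : ℕ) (ℓ : List ℕ) (t : ℕ) :
    List (BStr × List BStr) :=
  (enumL (BStr × List BStr) t).filter (fun a => decide (BadC U c n ℓ t a))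

noncomputable def vidx (U : UniversalPrefixMachine) (c n : ℕ) (ℓ : List ℕ) (e t : ℕ) : ℕ :=
  ((badL U c n ℓ t).map (fun a => min (2 ^ e) a.2.length)).sum / 2 ^ e

noncomputable def goodL (U : UniversalPrefixMachine) (c n : ℕ) (ℓ : List ℕ) (t : ℕ) : List BStr :=
  (allStr n).filter (fun x => decide (¬ ∃ a ∈ badL U c n ℓ t, ∃ y ∈ a.2, y = x))

noncomputable def window (U : UniversalPrefixMachine) (c n : ℕ) (ℓ : List ℕ) (e t : ℕ) :
    List BStr :=
  (goodL U c n ℓ t).take (2 ^ e)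

section prim
variable {U : UniversalPrefixMachine} {γ : Type} [Primcodable γ]
  {c n t i e : γ → ℕ} {ℓ : γ → List ℕ} {r : γ → BStr}

theorem prim_ver (ht : Primrec t) (hr : Primrec r) (hi : Primrec i) (hn : Primrec n)
    (hl : Primrec ℓ) : PrimrecPred fun g => Ver U (t g) (r g) (i g) (n g) (ℓ g) := by
  refine prim_forall_lt (P := fun g j =>
    Chk U (t g) (r g) (code j) (code (i g, n g, (ℓ g).getD j 0))) (Primrec.list_length.comp hl) ?_
  refine prim_chk (ht.comp Primrec.fst) (hr.comp Primrec.fst) (prim_code Primrec.snd)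
    (prim_code ?_)
  exact (hi.comp Primrec.fst).pair ((hn.comp Primrec.fst).pair
    ((Primrec.list_getD 0).comp (hl.comp Primrec.fst) Primrec.snd))

theorem prim_badC (hc : Primrec c) (hn : Primrec n) (hl : Primrec ℓ) (ht : Primrec t)
    {a : γ → BStr × List BStr} (ha : Primrec a) :
    PrimrecPred fun g => BadC U (c g) (n g) (ℓ g) (t g) (a g) := by
  have hk : Primrec fun g => (ℓ g).length - 1 :=
    Primrec.nat_sub.comp (Primrec.list_length.comp hl) (Primrec.const 1)
  have hq : Primrec fun g => (a g).1.length := Primrec.list_length.comp (Primrec.fst.comp ha)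
  refine PrimrecPred.and (Primrec.nat_le.comp hq hk) (PrimrecPred.and
    (prim_chk ht (Primrec.fst.comp ha) (Primrec.const []) (prim_code (Primrec.snd.comp ha))) ?_)
  refine prim_exists_mem (P := fun g r => Ver U (t g) r 0 (n g) (ℓ g) ∧
      2 ^ (a g).1.length * (a g).2.length <
        2 ^ ((ℓ g).getD (min ((ℓ g).length - 1) (max (a g).1.length (r.length + c g))) 0))
      (prim_enumL ht) (PrimrecPred.and ?_ ?_)
  · exact prim_ver (ht.comp Primrec.fst) Primrec.snd (Primrec.const 0) (hn.comp Primrec.fst)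
      (hl.comp Primrec.fst)
  · refine Primrec.nat_lt.comp (Primrec.nat_mul.comp (prim_pow2 (hq.comp Primrec.fst))
      (Primrec.list_length.comp (Primrec.snd.comp (ha.comp Primrec.fst)))) (prim_pow2 ?_)
    refine (Primrec.list_getD 0).comp (hl.comp Primrec.fst) ?_
    refine Primrec.nat_min.comp (hk.comp Primrec.fst) (Primrec.nat_max.comp
      (hq.comp Primrec.fst) (Primrec.nat_add.comp (Primrec.list_length.comp Primrec.snd)
      (hc.comp Primrec.fst)))

theorem prim_badL (hc : Primrec c) (hn : Primrec n) (hl : Primrec ℓ) (ht : Primrec t) :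
    Primrec fun g => badL U (c g) (n g) (ℓ g) (t g) :=
  prim_filter (P := fun g a => BadC U (c g) (n g) (ℓ g) (t g) a) (prim_enumL ht)
    (prim_badC (hc.comp Primrec.fst) (hn.comp Primrec.fst) (hl.comp Primrec.fst)
      (ht.comp Primrec.fst) Primrec.snd)

theorem prim_vidx (hc : Primrec c) (hn : Primrec n) (hl : Primrec ℓ) (he : Primrec e)
    (ht : Primrec t) : Primrec fun g => vidx U (c g) (n g) (ℓ g) (e g) (t g) := by
  refine Primrec.nat_div.comp (prim_sum (h := fun g (a : BStr × List BStr) =>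
    min (2 ^ e g) a.2.length) (prim_badL hc hn hl ht) ?_) (prim_pow2 he)
  exact Primrec.nat_min.comp (prim_pow2 (he.comp Primrec.fst))
    (Primrec.list_length.comp (Primrec.snd.comp Primrec.snd))

theorem prim_window (hc : Primrec c) (hn : Primrec n) (hl : Primrec ℓ) (he : Primrec e)
    (ht : Primrec t) : Primrec fun g => window U (c g) (n g) (ℓ g) (e g) (t g) := by
  refine Primrec.list_take.comp (prim_pow2 he) ?_
  refine prim_filter (P := fun g x => ¬ ∃ a ∈ badL U (c g) (n g) (ℓ g) (t g), ∃ y ∈ a.2, y = x)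
    (prim_allStr hn) (PrimrecPred.not ?_)
  refine prim_exists_mem (P := fun (g : γ × BStr) (a : BStr × List BStr) => ∃ y ∈ a.2, y = g.2)
    ((prim_badL hc hn hl ht).comp Primrec.fst) ?_
  refine prim_exists_mem (P := fun (g : (γ × BStr) × (BStr × List BStr)) (y : BStr) => y = g.1.2)
    (Primrec.snd.comp Primrec.snd) ?_
  exact Primrec.eq.comp Primrec.snd (Primrec.snd.comp (Primrec.fst.comp Primrec.fst))

end prim

/-! ## The main machine -/

def Jf (c b i pl : ℕ) : ℕ := i - b * (pl + c)

def Ef (c b i pl : ℕ) (ℓ : List ℕ) : ℕ :=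
  ℓ.getD (if i = 0 then min (ℓ.length - 1) (pl + c) else Jf c b i pl) 0 - Jf c b i pl

/-- Certificates. -/
abbrev Cert : Type := (ℕ × ℕ) × (BStr × BStr) × ℕ × (ℕ × ℕ × List ℕ) × ℕ

/-- `ℓ` is a table of values ending at the first fixed point. -/
def Tab (ℓ : List ℕ) : Prop :=
  0 < ℓ.length ∧ ℓ.getD (ℓ.length - 1) 0 = ℓ.length - 1 ∧ ∀ j < ℓ.length - 1, ¬ ℓ.getD j 0 = j

def MCond (U : UniversalPrefixMachine) (r : BStr) (d b : ℕ) (p w : BStr) (t₁ i n : ℕ)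
    (ℓ : List ℕ) (t₂ : ℕ) : Prop :=
  r = una (2 * d + b) (p ++ w) ∧ b < 2 ∧ Tab ℓ ∧ Ver U t₁ p i n ℓ ∧
    (allStr (Jf (2 ^ d) b i p.length + 1))[vidx U (2 ^ d) n ℓ (Ef (2 ^ d) b i p.length ℓ) t₂]?
      = some w

theorem MCond.prefixFree {U : UniversalPrefixMachine} {r r' : BStr} {d b d' b' : ℕ}
    {p w p' w' : BStr} {t₁ i n t₁' i' n' t₂ t₂' : ℕ} {ℓ ℓ' : List ℕ}
    (h : MCond U r d b p w t₁ i n ℓ t₂) (h' : MCond U r' d' b' p' w' t₁' i' n' ℓ' t₂')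
    (hr : r <+: r') : d = d' ∧ b = b' ∧ p = p' ∧ w = w' ∧ i = i' ∧ n = n' ∧ ℓ = ℓ' := by
  obtain ⟨h1, h2, ⟨h3, h4, h5⟩, h6, h7⟩ := h
  obtain ⟨h1', h2', ⟨h3', h4', h5'⟩, h6', h7'⟩ := h'
  subst h1 h1'
  obtain ⟨e1, e2⟩ := una_pf hr
  have hd : d = d' := by omega
  have hb : b = b' := by omega
  subst hd hb
  have hp : p = p' := by
    have a1 : p <+: p' ++ w' := (List.prefix_append p w).trans e2
    rcases prefix_cases a1 (List.prefix_append p' w') with hh | hh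
    · exact (h6 0 h3).prefixFree (h6' 0 h3') hh
    · exact ((h6' 0 h3').prefixFree (h6 0 h3) hh).symm
  subst hp
  have hv : ∀ j, j < ℓ.length → j < ℓ'.length → i = i' ∧ n = n' ∧ ℓ.getD j 0 = ℓ'.getD j 0 := by
    intro j hj hj'
    have := code_inj ((h6 j hj).unique (h6' j hj'))
    simpa [Prod.ext_iff] using this
  obtain ⟨hi, hn, -⟩ := hv 0 h3 h3'
  subst hi hn
  have hlen : ℓ.length = ℓ'.length := by
    rcases lt_trichotomy ℓ.length ℓ'.length with hh | hh | hh
    · exact absurd (((hv (ℓ.length - 1) (by omega) (by omega)).2.2).symm.trans h4)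
        (h5' _ (by omega))
    · exact hh
    · exact absurd (((hv (ℓ'.length - 1) (by omega) (by omega)).2.2).trans h4')
        (h5 _ (by omega))
  have hl : ℓ = ℓ' := by
    refine List.ext_getElem hlen fun j a1 a2 => ?_
    have := (hv j a1 a2).2.2
    simpa [List.getD_eq_getElem?_getD, a1, a2] using this
  subst hl
  have w1 : w.length = _ := mem_allStr.1 (List.mem_of_getElem? h7)
  have w2 : w'.length = _ := mem_allStr.1 (List.mem_of_getElem? h7')
  have w3 : w <+: w' := by simpa using e2
  exact ⟨rfl, rfl, rfl, w3.eq_of_length (w1.trans w2.symm), rfl, rfl, rfl⟩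

theorem main_machine (U : UniversalPrefixMachine) : ∃ s : BStr,
    ∀ r d b p w t₁ i n ℓ t₂, MCond U r d b p w t₁ i n ℓ t₂ →
      ∃ t, (allStr (Jf (2 ^ d) b i p.length + 1))[vidx U (2 ^ d) n ℓ
          (Ef (2 ^ d) b i p.length ℓ) t]? = some w ∧
        code (window U (2 ^ d) n ℓ (Ef (2 ^ d) b i p.length ℓ) t) ∈ U.eval (s ++ r) [] := by
  have key : ∀ {γ : Type} [Primcodable γ] (f : γ → Cert), Primrec f →
      (Primrec fun g => (f g).1.1) ∧ (Primrec fun g => (f g).1.2) ∧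
      (Primrec fun g => (f g).2.1.1) ∧ (Primrec fun g => (f g).2.1.2) ∧
      (Primrec fun g => (f g).2.2.1) ∧ (Primrec fun g => (f g).2.2.2.1.1) ∧
      (Primrec fun g => (f g).2.2.2.1.2.1) ∧ (Primrec fun g => (f g).2.2.2.1.2.2) ∧
      (Primrec fun g => (f g).2.2.2.2) := by
    intro γ _ f hf
    have s1 := Primrec.snd.comp hf
    have s2 := Primrec.snd.comp s1
    have s3 := Primrec.snd.comp s2
    have s4 := Primrec.fst.comp s3
    have s5 := Primrec.snd.comp s4
    exact ⟨Primrec.fst.comp (Primrec.fst.comp hf), Primrec.snd.comp (Primrec.fst.comp hf),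
      Primrec.fst.comp (Primrec.fst.comp s1), Primrec.snd.comp (Primrec.fst.comp s1),
      Primrec.fst.comp s2, Primrec.fst.comp s4, Primrec.fst.comp s5, Primrec.snd.comp s5,
      Primrec.snd.comp s3⟩
  have keyJ : ∀ {γ : Type} [Primcodable γ] (d b i : γ → ℕ) (p : γ → BStr),
      Primrec d → Primrec b → Primrec i → Primrec p →
      Primrec fun g => Jf (2 ^ d g) (b g) (i g) (p g).length := by
    intro γ _ d b i p hd hb hi hp
    exact Primrec.nat_sub.comp hi (Primrec.nat_mul.comp hb
      (Primrec.nat_add.comp (Primrec.list_length.comp hp) (prim_pow2 hd)))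
  have keyE : ∀ {γ : Type} [Primcodable γ] (d b i : γ → ℕ) (p : γ → BStr) (ℓ : γ → List ℕ),
      Primrec d → Primrec b → Primrec i → Primrec p → Primrec ℓ →
      Primrec fun g => Ef (2 ^ d g) (b g) (i g) (p g).length (ℓ g) := by
    intro γ _ d b i p ℓ hd hb hi hp hl
    have hJ := keyJ d b i p hd hb hi hp
    refine Primrec.nat_sub.comp ((Primrec.list_getD 0).comp hl (Primrec.ite
      (Primrec.eq.comp hi (Primrec.const 0)) ?_ hJ)) hJ
    exact Primrec.nat_min.comp (Primrec.nat_sub.comp (Primrec.list_length.comp hl)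
      (Primrec.const 1)) (Primrec.nat_add.comp (Primrec.list_length.comp hp) (prim_pow2 hd))
  obtain ⟨s, hs⟩ := machine U (C := Cert)
    (fun r _ a => MCond U r a.1.1 a.1.2 a.2.1.1 a.2.1.2 a.2.2.1 a.2.2.2.1.1 a.2.2.2.1.2.1
      a.2.2.2.1.2.2 a.2.2.2.2)
    (fun a => code (window U (2 ^ a.1.1) a.2.2.2.1.2.1 a.2.2.2.1.2.2
      (Ef (2 ^ a.1.1) a.1.2 a.2.2.2.1.1 a.2.1.1.length a.2.2.2.1.2.2) a.2.2.2.2))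
    (by
      obtain ⟨hd, hb, hp, hw, ht₁, hi, hn, hl, ht₂⟩ :=
        key (fun x : (BStr × BStr) × Cert => x.2) Primrec.snd
      have hlen := Primrec.list_length.comp hl
      have hlen1 := Primrec.nat_sub.comp hlen (Primrec.const 1)
      refine PrimrecPred.and ?_ (PrimrecPred.and ?_ (PrimrecPred.and ?_ (PrimrecPred.and ?_ ?_)))
      · exact Primrec.eq.comp (Primrec.fst.comp Primrec.fst)
          (prim_una (Primrec.nat_add.comp (Primrec.nat_mul.comp (Primrec.const 2) hd) hb)
            (Primrec.list_append.comp hp hw))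
      · exact Primrec.nat_lt.comp hb (Primrec.const 2)
      · refine PrimrecPred.and (Primrec.nat_lt.comp (Primrec.const 0) hlen) (PrimrecPred.and ?_ ?_)
        · exact Primrec.eq.comp ((Primrec.list_getD 0).comp hl hlen1) hlen1
        · refine prim_forall_lt (P := fun (x : (BStr × BStr) × Cert) j =>
            ¬ x.2.2.2.2.1.2.2.getD j 0 = j) hlen1 (PrimrecPred.not ?_)
          exact Primrec.eq.comp ((Primrec.list_getD 0).comp (hl.comp Primrec.fst) Primrec.snd)
            Primrec.snd
      · exact prim_ver ht₁ hp hi hn hl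
      · refine Primrec.eq.comp (Primrec.list_getElem?.comp (prim_allStr
          (Primrec.nat_add.comp (keyJ _ _ _ _ hd hb hi hp) (Primrec.const 1)))
          (prim_vidx (prim_pow2 hd) hn hl (keyE _ _ _ _ _ hd hb hi hp hl) ht₂))
          (Primrec.option_some.comp hw))
    (by
      obtain ⟨hd, hb, hp, hw, ht₁, hi, hn, hl, ht₂⟩ := key (fun x : Cert => x) Primrec.id
      exact prim_code (prim_window (prim_pow2 hd) hn hl (keyE _ _ _ _ _ hd hb hi hp hl) ht₂))
    (by
      intro y r r' a a' h h' hr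
      obtain ⟨e1, e2, e3, e4, -⟩ := h.prefixFree h' hr
      rw [h.1, h'.1, e1, e2, e3, e4])
  refine ⟨s, fun r d b p w t₁ i n ℓ t₂ h => ?_⟩
  obtain ⟨a, h1, h2⟩ := hs r [] ((d, b), (p, w), t₁, (i, n, ℓ), t₂) h
  obtain ⟨e1, e2, e3, e4, e5, e6, e7⟩ := h1.prefixFree h List.prefix_rfl
  refine ⟨a.2.2.2.2, ?_, ?_⟩
  · have := h1.2.2.2.2
    rwa [e1, e2, e3, e4, e5, e6, e7] at this
  · rwa [e1, e2, e3, e5, e6, e7] at h2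

end VV

/-! ## Kraft inequality and the combinatorial argument -/

namespace VV

open Encodable

theorem ud_of_prefixFree {S : Set BStr} (hne : ([] : BStr) ∉ S)
    (hpf : ∀ a ∈ S, ∀ b ∈ S, a <+: b → a = b) : InformationTheory.UniquelyDecodable S := by
  intro L₁
  induction L₁ with
  | nil =>
    intro L₂ _ h2 h
    cases L₂ with
    | nil => rfl
    | cons b L₂ =>
      have hb : b = [] := by
        have h' := h.symm
        simp only [List.flatten_cons, List.flatten_nil, List.append_eq_nil_iff] at h'
        exact h'.1
      exact absurd (hb ▸ h2 b (by simp)) hne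
  | cons a L₁ ih =>
    intro L₂ h1 h2 h
    cases L₂ with
    | nil =>
      have hb : a = [] := by
        simp only [List.flatten_cons, List.flatten_nil, List.append_eq_nil_iff] at h
        exact h.1
      exact absurd (hb ▸ h1 a (by simp)) hne
    | cons b L₂ =>
      simp only [List.flatten_cons] at h
      have ha := h1 a (by simp)
      have hb := h2 b (by simp)
      have hab : a = b := by
        have a1 : a <+: b ++ L₂.flatten := h ▸ List.prefix_append a _
        rcases prefix_cases a1 (List.prefix_append b _) with hh | hh
        · exact hpf _ ha _ hb hh
        · exact (hpf _ hb _ ha hh).symm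
      subst hab
      rw [ih L₂ (fun w hw => h1 w (by simp [hw])) (fun w hw => h2 w (by simp [hw]))
        (List.append_cancel_left h)]

theorem kraft_sum {β : Type} {L : List (BStr × β)} (hnd : L.Nodup)
    (hpf : ∀ a ∈ L, ∀ b ∈ L, a.1 <+: b.1 → a = b) (wt : BStr × β → ℕ) (W : ℕ)
    (hW : ∀ a ∈ L, wt a * 2 ^ a.1.length ≤ W) : (L.map wt).sum ≤ W := by
  by_cases he : ∃ a ∈ L, a.1 = []
  · obtain ⟨a, ha, hae⟩ := he
    have hall : ∀ b ∈ L, b = a := fun b hb => (hpf a ha b hb (by rw [hae]; simp)).symm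
    have hL : L = [a] := by
      cases L with
      | nil => simp at ha
      | cons b L =>
        have hb := hall b (by simp)
        subst hb
        cases L with
        | nil => rfl
        | cons d L =>
          have hd := hall d (by simp)
          subst hd
          simp at hnd
    have := hW a ha
    rw [hae] at this
    rw [hL]
    simpa using this
  · have hinj : Set.InjOn Prod.fst (L.toFinset : Set (BStr × β)) := by
      intro a ha b hb hab
      simp only [List.coe_toFinset, Set.mem_ofPred_eq] at ha hb
      exact hpf a ha b hb (by rw [hab])
    have hud : InformationTheory.UniquelyDecodable
        ((L.toFinset.image Prod.fst : Finset BStr) : Set BStr) := by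
      refine ud_of_prefixFree ?_ ?_
      · intro h
        simp only [Finset.coe_image, List.coe_toFinset, Set.mem_image, Set.mem_ofPred_eq] at h
        exact he h
      · intro p hp q hq hpq
        simp only [Finset.coe_image, List.coe_toFinset, Set.mem_image, Set.mem_ofPred_eq] at hp hq
        obtain ⟨a, ha, rfl⟩ := hp
        obtain ⟨b, hb, rfl⟩ := hq
        rw [hpf a ha b hb hpq]
    have hk := InformationTheory.kraft_mcmillan_inequality hud
    rw [Finset.sum_image hinj] at hk
    have h1 : (L.map wt).sum = ∑ a ∈ L.toFinset, wt a := (List.sum_toFinset wt hnd).symm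
    rw [h1]
    have h2 : (∑ a ∈ L.toFinset, (wt a : ℝ)) ≤
        ∑ a ∈ L.toFinset, (W : ℝ) * (1 / (Fintype.card Bool : ℝ)) ^ a.1.length := by
      refine Finset.sum_le_sum fun a ha => ?_
      have h3 : ((wt a * 2 ^ a.1.length : ℕ) : ℝ) ≤ W := by
        exact_mod_cast hW a (List.mem_toFinset.1 ha)
      push_cast at h3
      rw [Fintype.card_bool, one_div, inv_pow, ← div_eq_mul_inv, le_div_iff₀ (by positivity)]
      exact_mod_cast h3
    rw [← Finset.mul_sum] at h2
    have h4 : (∑ a ∈ L.toFinset, (wt a : ℝ)) ≤ W := by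
      refine h2.trans ?_
      have : (0 : ℝ) ≤ W := by positivity
      nlinarith
    exact_mod_cast h4

/-- The table of `lam`. -/
def tab (k : ℕ) (lam : ℕ → ℕ) : List ℕ := (List.range (k + 1)).map lam

theorem tab_length (k : ℕ) (lam : ℕ → ℕ) : (tab k lam).length = k + 1 := by simp [tab]

theorem tab_getD {k : ℕ} {lam : ℕ → ℕ} {j : ℕ} (hj : j ≤ k) : (tab k lam).getD j 0 = lam j := by
  rw [List.getD_eq_getElem?_getD]
  simp [tab, List.getElem?_range (show j < k + 1 by omega)]

variable {U : UniversalPrefixMachine} {c n k : ℕ} {lam : ℕ → ℕ}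

theorem tab_tab (hmono : ∀ i j, i ≤ j → j ≤ k → lam j ≤ lam i) (hk : lam k = k) :
    Tab (tab k lam) := by
  refine ⟨by simp [tab_length], ?_, ?_⟩
  · rw [tab_length, Nat.add_sub_cancel, tab_getD le_rfl, hk]
  · intro j hj
    rw [tab_length, Nat.add_sub_cancel] at hj
    rw [tab_getD hj.le]
    have := hmono j k hj.le le_rfl
    omega

theorem ver_isProg {t i : ℕ} {p : BStr} (h : Ver U t p i n (tab k lam)) :
    IsProg U i n k lam p := by
  intro j hj
  have := (h j (by rw [tab_length]; omega)).mem
  rwa [tab_getD hj] at this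

theorem isProg_ver {i : ℕ} {p : BStr} (h : IsProg U i n k lam p) :
    ∃ t₀, ∀ t, t₀ ≤ t → Ver U t p i n (tab k lam) := by
  have h1 : ∀ j, ∃ t, j ≤ k → Chk U t p (code j) (code (i, n, lam j)) := by
    intro j
    by_cases hj : j ≤ k
    · obtain ⟨t, ht⟩ := chk_spec.1 (h j hj)
      exact ⟨t, fun _ => ht⟩
    · exact ⟨0, fun h => absurd h hj⟩
  choose f hf using h1
  refine ⟨(Finset.range (k + 1)).sup f, fun t ht j hj => ?_⟩
  rw [tab_length] at hj
  rw [tab_getD (by omega)]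
  exact (hf j (by omega)).mono ((Finset.le_sup (f := f) (Finset.mem_range.2 hj)).trans ht)

/-- Finally bad pairs. -/
def FBad (U : UniversalPrefixMachine) (c n k : ℕ) (lam : ℕ → ℕ) (a : BStr × List BStr) : Prop :=
  a.1.length ≤ k ∧ code a.2 ∈ U.eval a.1 [] ∧
    2 ^ a.1.length * a.2.length <
      2 ^ (lam (min k (max a.1.length (KfunInfo U 0 n k lam + c))))

theorem fbad_of_mem (hmono : ∀ i j, i ≤ j → j ≤ k → lam j ≤ lam i) {t : ℕ}
    {a : BStr × List BStr} (h : a ∈ badL U c n (tab k lam) t) : FBad U c n k lam a := by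
  simp only [badL, List.mem_filter, decide_eq_true_eq] at h
  obtain ⟨-, h1, h2, r, -, h3, h4⟩ := h
  rw [tab_length, Nat.add_sub_cancel] at h1 h4
  rw [tab_getD (by omega)] at h4
  refine ⟨h1, h2.mem, h4.trans_le (Nat.pow_le_pow_right (by norm_num) (hmono _ _ ?_ (by omega)))⟩
  have := Kfun_le (ver_isProg h3)
  omega

theorem mem_of_fbad {a : BStr × List BStr} (h : FBad U c n k lam a) :
    ∃ t₀, ∀ t, t₀ ≤ t → a ∈ badL U c n (tab k lam) t := by
  obtain ⟨h1, h2, h3⟩ := h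
  obtain ⟨p, hp, hpp⟩ := exists_Kfun U 0 n k lam
  obtain ⟨t1, ht1⟩ := isProg_ver hpp
  obtain ⟨t2, ht2⟩ := chk_spec.1 h2
  refine ⟨max (max t1 t2) (max (encode p + 1) (encode a + 1)), fun t ht => ?_⟩
  simp only [badL, List.mem_filter, decide_eq_true_eq, mem_enumL]
  refine ⟨by omega, ?_, ht2.mono (by omega), p, mem_enumL.2 (by omega), ht1 t (by omega), ?_⟩
  · rw [tab_length]; omega
  · rw [tab_length, Nat.add_sub_cancel, tab_getD (by omega), hp]
    exact h3

theorem fbad_pf {a b : BStr × List BStr} (ha : FBad U c n k lam a)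
    (hb : FBad U c n k lam b) (h : a.1 <+: b.1) : a = b := by
  have h1 : a.1 = b.1 := U.prefixFree [] _ _ (Part.dom_iff_mem.2 ⟨_, ha.2.1⟩)
    (Part.dom_iff_mem.2 ⟨_, hb.2.1⟩) h
  have h2 := ha.2.1
  rw [h1] at h2
  exact Prod.ext h1 (code_inj (Part.mem_unique h2 hb.2.1))

theorem exists_stable (hmono : ∀ i j, i ≤ j → j ≤ k → lam j ≤ lam i) :
    ∃ t, ∀ a, a ∈ badL U c n (tab k lam) t ↔ FBad U c n k lam a := by
  have hfin : {a | FBad U c n k lam a}.Finite := by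
    refine Set.Finite.of_finite_image (f := Prod.fst) ?_ ?_
    · refine (List.finite_length_le Bool k).subset ?_
      rintro _ ⟨a, ha, rfl⟩
      exact ha.1
    · intro a ha b hb hab
      exact fbad_pf ha hb (by rw [hab])
  have h1 : ∀ a, ∃ t₀, FBad U c n k lam a → ∀ t, t₀ ≤ t → a ∈ badL U c n (tab k lam) t := by
    intro a
    by_cases ha : FBad U c n k lam a
    · obtain ⟨t, ht⟩ := mem_of_fbad ha
      exact ⟨t, fun _ => ht⟩
    · exact ⟨0, fun h => absurd h ha⟩
  choose f hf using h1
  obtain ⟨t, ht⟩ := (hfin.image f).bddAbove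
  exact ⟨t, fun a => ⟨fbad_of_mem hmono, fun ha => hf a ha t (ht ⟨a, ha, rfl⟩)⟩⟩

theorem badL_nodup (t : ℕ) (ℓ : List ℕ) : (badL U c n ℓ t).Nodup := (enumL_nodup _).filter _

theorem length_le_of_cover {L : List BStr} {D : List (BStr × List BStr)} (hL : L.Nodup)
    (h : ∀ x ∈ L, ∃ a ∈ D, x ∈ a.2) : L.length ≤ (D.map (fun a => a.2.length)).sum := by
  have h1 : L ⊆ D.flatMap (fun a => a.2) := by
    intro x hx
    rw [List.mem_flatMap]
    exact h x hx
  have := (List.subperm_of_subset hL h1).length_le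
  rwa [List.length_flatMap] at this

theorem sum_min_lt {D : List (BStr × List BStr)} {M : ℕ}
    (h : (D.map (fun a => min M a.2.length)).sum < M) : (D.map (fun a => a.2.length)).sum < M := by
  induction D with
  | nil => simpa using h
  | cons a D ih =>
    simp only [List.map_cons, List.sum_cons] at h ⊢
    have h1 : a.2.length < M := by
      by_contra hh
      rw [min_eq_left (by omega)] at h
      omega
    rw [min_eq_right h1.le] at h
    have key : ∀ D : List (BStr × List BStr), (D.map (fun a => min M a.2.length)).sum < M →
      (D.map (fun a => min M a.2.length)).sum = (D.map (fun a => a.2.length)).sum := by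
      intro D
      induction D with
      | nil => simp
      | cons b D ih2 =>
        intro h
        simp only [List.map_cons, List.sum_cons] at h ⊢
        rw [ih2 (by omega), min_eq_right]
        by_contra hh
        rw [min_eq_left (by omega)] at h
        omega
    rw [← key D (by omega)]
    exact h

/-- The key window lemma. -/
theorem mem_window (hmono : ∀ i j, i ≤ j → j ≤ k → lam j ≤ lam i) {ts t e : ℕ}
    (hts : ∀ a, a ∈ badL U c n (tab k lam) ts ↔ FBad U c n k lam a) {x : BStr} {L1 L2 : List BStr}
    (hx : ∀ a, FBad U c n k lam a → x ∉ a.2) (hL : allStr n = L1 ++ x :: L2)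
    (hL1 : ∀ y ∈ L1, ∃ a, FBad U c n k lam a ∧ y ∈ a.2)
    (hv : vidx U c n (tab k lam) e t = vidx U c n (tab k lam) e ts) :
    x ∈ window U c n (tab k lam) e t := by
  set A := badL U c n (tab k lam) t with hA
  set B := badL U c n (tab k lam) ts with hB
  set D := B.filter (fun a => decide (a ∉ A)) with hD
  have hAB : ∀ a ∈ A, a ∈ B := fun a ha => (hts a).2 (fbad_of_mem hmono ha)
  have hperm : (A ++ D).Perm B := by
    refine (List.perm_ext_iff_of_nodup ?_ (badL_nodup _ _)).2 ?_
    · refine List.Nodup.append (badL_nodup _ _) ((badL_nodup _ _).filter _) ?_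
      intro a ha hd
      simp only [hD, List.mem_filter, decide_eq_true_eq] at hd
      exact hd.2 ha
    · intro a
      simp only [hD, List.mem_append, List.mem_filter, decide_eq_true_eq]
      constructor
      · rintro (h | h)
        · exact hAB a h
        · exact h.1
      · intro h
        by_cases ha : a ∈ A
        · exact Or.inl ha
        · exact Or.inr ⟨h, ha⟩
  have hsum := (hperm.map (fun a => min (2 ^ e) a.2.length)).sum_eq
  rw [List.map_append, List.sum_append] at hsum
  have hDlt : (D.map (fun a => min (2 ^ e) a.2.length)).sum < 2 ^ e := by
    simp only [vidx, ← hA, ← hB, ← hsum] at hv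
    by_contra hh
    have h2 : 0 < 2 ^ e := by positivity
    have : ((A.map (fun a => min (2 ^ e) a.2.length)).sum + 2 ^ e) / 2 ^ e ≤
        ((A.map (fun a => min (2 ^ e) a.2.length)).sum +
          (D.map (fun a => min (2 ^ e) a.2.length)).sum) / 2 ^ e :=
      Nat.div_le_div_right (by omega)
    rw [Nat.add_div_right _ h2] at this
    omega
  have hDlt2 := sum_min_lt hDlt
  have hxg : decide (¬ ∃ a ∈ A, ∃ y ∈ a.2, y = x) = true := by
    rw [decide_eq_true_eq]
    rintro ⟨a, ha, y, hy, rfl⟩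
    exact hx a (fbad_of_mem hmono ha) hy
  have hnd := allStr_nodup n
  rw [hL] at hnd
  have hlen : (L1.filter (fun x => decide (¬ ∃ a ∈ A, ∃ y ∈ a.2, y = x))).length < 2 ^ e := by
    refine (length_le_of_cover (D := D) ((List.nodup_append.1 hnd).1.filter _) ?_).trans_lt hDlt2
    intro y hy
    simp only [List.mem_filter, decide_eq_true_eq] at hy
    obtain ⟨a, ha, hya⟩ := hL1 y hy.1
    refine ⟨a, ?_, hya⟩
    simp only [hD, List.mem_filter, decide_eq_true_eq]
    exact ⟨(hts a).2 ha, fun hh => hy.2 ⟨a, hh, y, hya, rfl⟩⟩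
  simp only [window, goodL, ← hA, hL]
  rw [List.filter_append, List.filter_cons_of_pos (p := fun x => decide (¬ ∃ a ∈ A, ∃ y ∈ a.2, y = x)) hxg, List.take_append, List.mem_append]
  right
  obtain ⟨m, hm⟩ := Nat.exists_eq_add_of_lt hlen
  rw [show 2 ^ e - (L1.filter (fun x => decide (¬ ∃ a ∈ A, ∃ y ∈ a.2, y = x))).length = m + 1 by
    omega]
  simp

theorem vidx_le (hmono : ∀ i j, i ≤ j → j ≤ k → lam j ≤ lam i) {t e J : ℕ}
    (hJ : lam (min k (max J (KfunInfo U 0 n k lam + c))) ≤ e + J) :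
    vidx U c n (tab k lam) e t ≤ 2 ^ J := by
  have : ((badL U c n (tab k lam) t).map (fun a => min (2 ^ e) a.2.length)).sum ≤ 2 ^ (e + J) := by
    refine kraft_sum (badL_nodup _ _) (fun a ha b hb h =>
      fbad_pf (fbad_of_mem hmono ha) (fbad_of_mem hmono hb) h) _ _ ?_
    intro a ha
    obtain ⟨h1, -, h3⟩ := fbad_of_mem hmono ha
    rcases le_total a.1.length J with h | h
    · rw [pow_add]
      exact Nat.mul_le_mul (min_le_left _ _) (Nat.pow_le_pow_right (by norm_num) h)
    · have h5 : lam (min k (max a.1.length (KfunInfo U 0 n k lam + c))) ≤ e + J :=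
        (hmono _ _ (by omega) (by omega)).trans hJ
      have h6 := h3.le.trans (Nat.pow_le_pow_right (by norm_num) h5)
      rw [mul_comm] at h6
      exact (Nat.mul_le_mul_right _ (min_le_right _ _)).trans h6
  rw [vidx]
  refine Nat.div_le_of_le_mul ?_
  rwa [← pow_add]

theorem exists_first (hmono : ∀ i j, i ≤ j → j ≤ k → lam j ≤ lam i) (h0 : lam 0 ≤ n) {ts : ℕ}
    (hts : ∀ a, a ∈ badL U c n (tab k lam) ts ↔ FBad U c n k lam a) :
    ∃ (x : BStr) (L1 L2 : List BStr), (∀ a, FBad U c n k lam a → x ∉ a.2) ∧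
      allStr n = L1 ++ x :: L2 ∧ ∀ y ∈ L1, ∃ a, FBad U c n k lam a ∧ y ∈ a.2 := by
  have hsum : ((badL U c n (tab k lam) ts).map (fun a => a.2.length)).sum ≤ 2 ^ n - 1 := by
    refine kraft_sum (badL_nodup _ _) (fun a ha b hb h =>
      fbad_pf (fbad_of_mem hmono ha) (fbad_of_mem hmono hb) h) _ _ ?_
    intro a ha
    obtain ⟨h1, -, h3⟩ := fbad_of_mem hmono ha
    have h5 := (hmono 0 (min k (max a.1.length (KfunInfo U 0 n k lam + c))) (by omega)
      (by omega)).trans h0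
    have h6 := h3.trans_le (Nat.pow_le_pow_right (by norm_num) h5)
    rw [mul_comm] at h6
    exact Nat.le_sub_one_of_lt h6
  have hex : ∃ x ∈ allStr n, ∀ a, FBad U c n k lam a → x ∉ a.2 := by
    by_contra hh
    push Not at hh
    have h1 := length_le_of_cover (D := badL U c n (tab k lam) ts) (allStr_nodup n) (by
      intro x hx
      obtain ⟨a, ha, hxa⟩ := hh x hx
      exact ⟨a, (hts a).2 ha, hxa⟩)
    rw [allStr_length] at h1
    have : 0 < 2 ^ n := by positivity
    omega
  obtain ⟨x, hx⟩ : ∃ x, (allStr n).find?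
      (fun x => decide (∀ a, FBad U c n k lam a → x ∉ a.2)) = some x := by
    rw [← Option.isSome_iff_exists, List.find?_isSome]
    obtain ⟨x, hx, h⟩ := hex
    exact ⟨x, hx, by simpa using h⟩
  rw [List.find?_eq_some_iff_append] at hx
  obtain ⟨h1, L1, L2, h2, h3⟩ := hx
  refine ⟨x, L1, L2, of_decide_eq_true h1, h2, fun y hy => ?_⟩
  have := h3 y hy
  rw [Bool.not_eq_true', decide_eq_false_iff_not] at this
  push Not at this
  exact this

theorem exists_x (s : BStr) (d : ℕ)
    (hs : ∀ r d b p w t₁ i n ℓ t₂, MCond U r d b p w t₁ i n ℓ t₂ →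
      ∃ t, (allStr (Jf (2 ^ d) b i p.length + 1))[vidx U (2 ^ d) n ℓ
          (Ef (2 ^ d) b i p.length ℓ) t]? = some w ∧
        code (window U (2 ^ d) n ℓ (Ef (2 ^ d) b i p.length ℓ) t) ∈ U.eval (s ++ r) [])
    (hmono : ∀ i j, i ≤ j → j ≤ k → lam j ≤ lam i) (h0 : lam 0 ≤ n) (hk : lam k = k) :
    ∃ x : BStr, x.length = n ∧ (∀ a, FBad U (2 ^ d) n k lam a → x ∉ a.2) ∧
      ∀ i b p, IsProg U i n k lam p → b < 2 →
        lam (min k (max (Jf (2 ^ d) b i p.length) (KfunInfo U 0 n k lam + 2 ^ d))) ≤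
          Ef (2 ^ d) b i p.length (tab k lam) + Jf (2 ^ d) b i p.length →
        ∃ S : Finset BStr, x ∈ S ∧ S.card ≤ 2 ^ Ef (2 ^ d) b i p.length (tab k lam) ∧
          U.Kset S ≤ s.length + 2 * d + b + 2 + p.length + Jf (2 ^ d) b i p.length := by
  obtain ⟨ts, hts⟩ := exists_stable (U := U) (c := 2 ^ d) (n := n) hmono
  obtain ⟨x, L1, L2, hx, hL, hL1⟩ := exists_first hmono h0 hts
  refine ⟨x, mem_allStr.1 (by rw [hL]; simp), hx, fun i b p hp hb hJ => ?_⟩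
  set E := Ef (2 ^ d) b i p.length (tab k lam)
  set J := Jf (2 ^ d) b i p.length with hJdef
  have hv := vidx_le (t := ts) hmono hJ
  have hlt : vidx U (2 ^ d) n (tab k lam) E ts < (allStr (J + 1)).length := by
    rw [allStr_length, pow_succ]
    have : 0 < 2 ^ J := by positivity
    omega
  obtain ⟨t₁, ht₁⟩ := isProg_ver hp
  have hw := List.getElem?_eq_getElem hlt
  set w := (allStr (J + 1))[vidx U (2 ^ d) n (tab k lam) E ts]
  have hwl : w.length = J + 1 := mem_allStr.1 (List.getElem_mem hlt)
  obtain ⟨t, h1, h2⟩ := hs (una (2 * d + b) (p ++ w)) d b p w t₁ i n (tab k lam) ts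
    ⟨rfl, hb, tab_tab hmono hk, ht₁ t₁ le_rfl, hw⟩
  have hveq : vidx U (2 ^ d) n (tab k lam) E t = vidx U (2 ^ d) n (tab k lam) E ts :=
    ((List.getElem?_inj hlt (allStr_nodup (J + 1))).1 (hw.trans h1.symm)).symm
  have hxw := mem_window hmono hts hx hL hL1 hveq
  have hsort : (window U (2 ^ d) n (tab k lam) E t).Pairwise (fun a b => encode a < encode b) :=
    ((allStr_sorted n).filter _).sublist (List.take_sublist _ _)
  refine ⟨(window U (2 ^ d) n (tab k lam) E t).toFinset, List.mem_toFinset.2 hxw, ?_, ?_⟩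
  · exact (List.toFinset_card_le _).trans (List.length_take_le _ _)
  · rw [UniversalPrefixMachine.Kset, code_toFinset hsort]
    refine (K_le h2).trans ?_
    rw [List.length_append, una_length, List.length_append, hwl]
    omega

theorem exists_sorted (S : Finset BStr) : ∃ l : List BStr, code l = code S ∧ l.length = S.card ∧
    ∀ x, x ∈ l ↔ x ∈ S := by
  set l := (enumL BStr (S.sup encode + 1)).filter (fun x => decide (x ∈ S)) with hl
  have hsort : l.Pairwise (fun a b => encode a < encode b) := (enumL_sorted _).filter _
  have hmem : ∀ x, x ∈ l ↔ x ∈ S := by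
    intro x
    simp only [hl, List.mem_filter, mem_enumL, decide_eq_true_eq]
    constructor
    · exact fun h => h.2
    · exact fun h => ⟨Nat.lt_succ_of_le (Finset.le_sup (f := encode) h), h⟩
  have hS : l.toFinset = S := by
    ext x; rw [List.mem_toFinset, hmem]
  refine ⟨l, ?_, ?_, hmem⟩
  · rw [← code_toFinset hsort, hS]
  · rw [← hS, List.toFinset_card_of_nodup ((enumL_nodup _).filter _)]

/-- Lower bound. -/
theorem lam_le_Lam {x : BStr} (hx : ∀ a, FBad U c n k lam a → x ∉ a.2) {S : Finset BStr}
    (hS : x ∈ S) (hK : U.Kset S ≤ k) :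
    ((lam (min k (max (U.Kset S) (KfunInfo U 0 n k lam + c))) : ℕ) : ℝ) ≤ U.Lam S := by
  obtain ⟨l, h1, h2, h3⟩ := exists_sorted S
  obtain ⟨q, hq, hq2⟩ := exists_K U (code S)
  change q.length = U.Kset S at hq
  have hnb : ¬ FBad U c n k lam (q, l) := fun h => hx _ h ((h3 x).2 hS)
  have h4 : 2 ^ lam (min k (max (U.Kset S) (KfunInfo U 0 n k lam + c))) ≤
      2 ^ U.Kset S * S.card := by
    by_contra hh
    refine hnb ⟨by simpa [hq] using hK, by simpa [h1] using hq2, ?_⟩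
    simp only [hq, h2]
    omega
  have hpos : (0 : ℝ) < S.card := by exact_mod_cast Finset.card_pos.2 ⟨x, hS⟩
  have h5 : ((2 : ℝ) ^ lam (min k (max (U.Kset S) (KfunInfo U 0 n k lam + c)))) ≤
      2 ^ U.Kset S * S.card := by exact_mod_cast h4
  have h6 := Real.logb_le_logb_of_le (b := 2) (by norm_num) (by positivity) h5
  rw [Real.logb_mul (by positivity) hpos.ne', Real.logb_pow, Real.logb_pow,
    Real.logb_self_eq_one (by norm_num), mul_one, mul_one] at h6
  exact h6

theorem Lam_le {S : Finset BStr} {x : BStr} (hx : x ∈ S) {E : ℕ} (h : S.card ≤ 2 ^ E) :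
    U.Lam S ≤ ((U.Kset S + E : ℕ) : ℝ) := by
  have hpos : (0 : ℝ) < S.card := by exact_mod_cast Finset.card_pos.2 ⟨x, hx⟩
  have h5 : (S.card : ℝ) ≤ 2 ^ E := by exact_mod_cast h
  have h6 := Real.logb_le_logb_of_le (b := 2) (by norm_num) hpos h5
  rw [Real.logb_pow, Real.logb_self_eq_one (by norm_num), mul_one] at h6
  rw [UniversalPrefixMachine.Lam]
  push_cast
  linarith

end VV

/-- There is a constant `c` such that for every `n`, `k ≤ n`, and
non-increasing integer-valued `λ` on `{0,…,k}` with `λ(0) ≤ n` and `λ(k) = k`,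
there is a string `x` of length `n` with `|K(x) − k| ≤ K(k,n,λ) + c` such that
`λ_x` is `(ε,δ)`-close to `λ` with `ε(i) = δ(i) = K(i,n,λ) + c`. -/
theorem statement5 (U : UniversalPrefixMachine) :
    ∃ c : ℕ, ∀ (n k : ℕ) (lam : ℕ → ℕ), k ≤ n →
      (∀ i j, i ≤ j → j ≤ k → lam j ≤ lam i) → lam 0 ≤ n → lam k = k →
      ∃ x : BStr, x.length = n ∧
        ((U.K x : ℤ) - (k : ℤ)).natAbs ≤ KfunInfo U k n k lam + c ∧
        IsClose k (fun i => KfunInfo U i n k lam + c) (fun i => KfunInfo U i n k lam + c)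
          (fun i => U.lambdaF x i) (fun i => (((lam i : ℕ) : ℝ) : EReal)) := by
  obtain ⟨s, hs⟩ := VV.main_machine U
  obtain ⟨c1, hc1⟩ := VV.Kfun_zero_le U
  obtain ⟨c2, hc2⟩ := VV.Kset_singleton_le U
  obtain ⟨c3, hc3⟩ := VV.K_le_Kset_singleton U
  obtain ⟨d, hd⟩ : ∃ d, s.length + 2 * d + 3 + c1 + c2 + c3 ≤ 2 ^ d := by
    refine ⟨s.length + 3 + c1 + c2 + c3 + 3, ?_⟩
    have h := Nat.lt_two_pow_self (n := s.length + 3 + c1 + c2 + c3)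
    rw [pow_add]
    omega
  refine ⟨2 ^ d, fun n k lam hkn hmono h0 hk => ?_⟩
  obtain ⟨x, hxn, hx, hmain⟩ := VV.exists_x s d hs hmono h0 hk
  obtain ⟨p0, hp0, hpp0⟩ := VV.exists_Kfun U 0 n k lam
  refine ⟨x, hxn, ?_, ?_⟩
  · obtain ⟨p, hp, hpp⟩ := VV.exists_Kfun U k n k lam
    have hJ : VV.Jf (2 ^ d) 0 k p.length = k := by simp [VV.Jf]
    have hE : VV.Ef (2 ^ d) 0 k p.length (VV.tab k lam) = 0 := by
      rw [VV.Ef, hJ, VV.tab_length, Nat.add_sub_cancel]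
      split_ifs with hk0
      · subst hk0
        rw [VV.tab_getD (by omega), Nat.zero_min, hk]
      · rw [VV.tab_getD le_rfl, hk, Nat.sub_self]
    obtain ⟨S, hxS, hcard, hKS⟩ := hmain k 0 p hpp (by norm_num) (by
      rw [hJ, hE, min_eq_left (le_max_left _ _), hk]; omega)
    rw [hJ] at hKS
    rw [hE, pow_zero] at hcard
    have hSx : S = {x} := by
      ext y
      rw [Finset.mem_singleton]
      exact ⟨fun hy => Finset.card_le_one.1 hcard y hy x hxS, fun hy => hy ▸ hxS⟩
    subst hSx
    have a1 := hc3 x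
    have a2 := hc2 x
    have a3 : k ≤ U.Kset {x} := by
      by_contra hh
      have h1 := VV.lam_le_Lam hx (Finset.mem_singleton_self x) (by omega)
      have h2 := VV.Lam_le (U := U) (Finset.mem_singleton_self x) (E := 0) (by simp)
      have h3 : lam (min k (max (U.Kset {x}) (KfunInfo U 0 n k lam + 2 ^ d))) ≤ U.Kset {x} := by
        exact_mod_cast h1.trans h2
      have h4 := hmono (min k (max (U.Kset {x}) (KfunInfo U 0 n k lam + 2 ^ d))) k (by omega) le_rfl
      omega
    omega
  · intro i hi hik
    simp only at hi ⊢
    set T := KfunInfo U 0 n k lam + 2 ^ d with hT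
    constructor
    · refine le_sInf ?_
      rintro _ ⟨S, hxS, hKS, rfl⟩
      have h1 := VV.lam_le_Lam hx hxS (hKS.trans hik)
      have h2 : lam i ≤ lam (min k (max (U.Kset S) T)) := hmono _ _ (by omega) hik
      have h3 : ((lam i : ℕ) : ℝ) ≤ U.Lam S := le_trans (by exact_mod_cast h2) h1
      have h4 : sInf {r : EReal | ∃ j, T ≤ j ∧ j ≤ k ∧
          Nat.dist j i ≤ KfunInfo U i n k lam + 2 ^ d ∧ r = (((lam j : ℕ) : ℝ) : EReal)} ≤
          (((lam i : ℕ) : ℝ) : EReal) :=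
        sInf_le ⟨i, hi, hik, by rw [Nat.dist_self]; omega, rfl⟩
      refine (EReal.sub_le_sub h4 le_rfl).trans ?_
      rw [← EReal.coe_sub, EReal.coe_le_coe_iff]
      have h5 : (0 : ℝ) ≤ ((KfunInfo U i n k lam + 2 ^ d : ℕ) : ℝ) := Nat.cast_nonneg _
      linarith
    · have key : ∃ (S : Finset BStr) (j : ℕ), x ∈ S ∧ U.Kset S ≤ i ∧ T ≤ j ∧ j ≤ k ∧
          Nat.dist j i ≤ KfunInfo U i n k lam + 2 ^ d ∧
          U.Lam S ≤ ((lam j + (KfunInfo U i n k lam + 2 ^ d) : ℕ) : ℝ) := by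
        by_cases hcase : i < T + (KfunInfo U i n k lam + 2 ^ d)
        · have hJ : VV.Jf (2 ^ d) 0 0 p0.length = 0 := by simp [VV.Jf]
          have hE : VV.Ef (2 ^ d) 0 0 p0.length (VV.tab k lam) = lam T := by
            rw [VV.Ef, hJ, VV.tab_length, Nat.add_sub_cancel, if_pos rfl, hp0, ← hT,
              min_eq_right (by omega), VV.tab_getD (by omega), Nat.sub_zero]
          obtain ⟨S, hxS, hcard, hKS⟩ := hmain 0 0 p0 hpp0 (by norm_num) (by
            rw [hJ, hE, Nat.zero_max, min_eq_right (by omega)]; omega)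
          rw [hJ, hp0] at hKS
          rw [hE] at hcard
          have hc := hc1 i n k lam
          refine ⟨S, T, hxS, by omega, le_rfl, by omega, ?_, ?_⟩
          · rw [Nat.dist_eq_sub_of_le hi]; omega
          · refine (VV.Lam_le hxS hcard).trans ?_
            exact_mod_cast (by omega : U.Kset S + lam T ≤ lam T + (KfunInfo U i n k lam + 2 ^ d))
        · obtain ⟨p, hp, hpp⟩ := VV.exists_Kfun U i n k lam
          have hi0 : i ≠ 0 := by omega
          obtain ⟨J, hJdef⟩ : ∃ J, J = i - (KfunInfo U i n k lam + 2 ^ d) := ⟨_, rfl⟩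
          have hJ : VV.Jf (2 ^ d) 1 i p.length = J := by rw [VV.Jf, one_mul, hp, hJdef]
          have hE : VV.Ef (2 ^ d) 1 i p.length (VV.tab k lam) = lam J - J := by
            rw [VV.Ef, if_neg hi0, hJ, VV.tab_getD (by omega)]
          have hlJ := hmono J k (by omega) le_rfl
          obtain ⟨S, hxS, hcard, hKS⟩ := hmain i 1 p hpp (by norm_num) (by
            rw [hJ, hE, max_eq_left (by omega), min_eq_right (by omega)]; omega)
          rw [hJ, hp] at hKS
          rw [hE] at hcard
          refine ⟨S, J, hxS, by omega, by omega, by omega, ?_, ?_⟩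
          · rw [Nat.dist_eq_sub_of_le (by omega)]; omega
          · refine (VV.Lam_le hxS hcard).trans ?_
            exact_mod_cast
              (by omega : U.Kset S + (lam J - J) ≤ lam J + (KfunInfo U i n k lam + 2 ^ d))
      obtain ⟨S, j, hxS, hKS, hj1, hj2, hj3, hL⟩ := key
      have h1 : U.lambdaF x i ≤ ((U.Lam S : ℝ) : EReal) := sInf_le ⟨S, hxS, hKS, rfl⟩
      have h2 : ((U.Lam S : ℝ) : EReal) ≤ (((lam j : ℕ) : ℝ) : EReal) +
          (((KfunInfo U i n k lam + 2 ^ d : ℕ) : ℝ) : EReal) := by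
        rw [← EReal.coe_add, EReal.coe_le_coe_iff]
        refine hL.trans (le_of_eq ?_)
        rw [Nat.cast_add (lam j)]
      refine h1.trans (h2.trans (add_le_add ?_ le_rfl))
      exact le_sSup ⟨j, hj1, hj2, hj3, rfl⟩
end
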